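/- Lerch's formula: log(d) + L'(0,χ)/L(0,χ) = (w/(2h)) · Σ_{0 < a < d} χ(a)·log Γ(a/d), where Γ is the Gamma function and L(s,χ) is the analytically continued Dirichlet L-function of χ (which satisfies L(0,χ) ≠ 0). -/

import Mathlib

open NumberField
lemma lf_hasDerivAt_cpow (c : ℂ) {y : ℝ} (hy : 0 < y) :
    HasDerivAt (fun y : ℝ => (y : ℂ) ^ c) (c * (y : ℂ) ^ (c - 1)) y := by
  have h1 : HasDerivAt (fun z : ℂ => z ^ c) (c * (y : ℂ) ^ (c - 1)) (y : ℂ) := by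
    have := (hasDerivAt_id (y : ℂ)).cpow_const (c := c) (by simp [Complex.mem_slitPlane_iff, hy])
    simpa using this
  exact h1.comp_ofReal

lemma lf_lip (c : ℂ) (hc : c.re ≤ 1) {A B : ℝ} (hA : 0 < A) (hAB : A ≤ B) :
    ‖(B : ℂ) ^ c - (A : ℂ) ^ c‖ ≤ ‖c‖ * A ^ (c.re - 1) * (B - A) := by
  have := (convex_Icc A B).norm_image_sub_le_of_norm_hasDerivWithin_le
    (f := fun y : ℝ => (y : ℂ) ^ c) (f' := fun y : ℝ => c * (y : ℂ) ^ (c - 1))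
    (C := ‖c‖ * A ^ (c.re - 1)) (x := A) (y := B)
    (fun y hy => (lf_hasDerivAt_cpow c (hA.trans_le hy.1)).hasDerivWithinAt) ?_
    (Set.left_mem_Icc.2 hAB) (Set.right_mem_Icc.2 hAB)
  · rwa [Real.norm_of_nonneg (sub_nonneg.2 hAB)] at this
  · intro y hy
    rw [norm_mul, Complex.norm_cpow_eq_rpow_re_of_pos (hA.trans_le hy.1)]
    refine mul_le_mul_of_nonneg_left ?_ (norm_nonneg _)
    simp only [Complex.sub_re, Complex.one_re]
    exact Real.rpow_le_rpow_of_nonpos hA hy.1 (by linarith)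

lemma lf_taylor (s : ℂ) (hs : -2 ≤ s.re) {A B : ℝ} (hA : 0 < A) (hAB : A ≤ B) (h1 : B - A ≤ 1) :
    ‖(A : ℂ) ^ (-s) - (B : ℂ) ^ (-s) + s * (A - B) * (B : ℂ) ^ (-s - 1)‖
      ≤ ‖s‖ * ‖s + 1‖ * A ^ (-s.re - 2) := by
  have := (convex_Icc A B).norm_image_sub_le_of_norm_hasDerivWithin_le
    (f := fun y : ℝ => (y : ℂ) ^ (-s) + s * y * (B : ℂ) ^ (-s - 1))
    (f' := fun y : ℝ => (-s) * (y : ℂ) ^ (-s - 1) + s * 1 * (B : ℂ) ^ (-s - 1))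
    (C := ‖s‖ * ‖s + 1‖ * A ^ (-s.re - 2)) (x := B) (y := A)
    (fun y hy => ?_) ?_
    (Set.right_mem_Icc.2 hAB) (Set.left_mem_Icc.2 hAB)
  · have h2 : ‖A - B‖ ≤ 1 := by
      rw [norm_sub_rev, Real.norm_of_nonneg (sub_nonneg.2 hAB)]; exact h1
    have h3 : (0:ℝ) ≤ ‖s‖ * ‖s + 1‖ * A ^ (-s.re - 2) := by positivity
    refine le_trans (le_of_eq ?_) (this.trans (mul_le_of_le_one_right h3 h2))
    congr 1
    ring
  · refine HasDerivAt.hasDerivWithinAt ?_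
    exact (lf_hasDerivAt_cpow (-s) (hA.trans_le hy.1)).add
      (((Complex.ofRealCLM.hasDerivAt (x := y)).const_mul s).mul_const _)
  · intro y hy
    have hy0 := hA.trans_le hy.1
    have := lf_lip (-s - 1) (by simp; linarith) hy0 hy.2
    rw [show -s * (y : ℂ) ^ (-s - 1) + s * 1 * (B : ℂ) ^ (-s - 1)
      = s * ((B : ℂ) ^ (-s - 1) - (y : ℂ) ^ (-s - 1)) by ring, norm_mul, mul_assoc]
    refine mul_le_mul_of_nonneg_left (this.trans ?_) (norm_nonneg _)
    rw [show -s - 1 = -(s+1) by ring, norm_neg, mul_assoc]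
    refine mul_le_mul_of_nonneg_left ?_ (norm_nonneg _)
    have e : (-(s+1)).re - 1 = -s.re - 2 := by simp; ring
    rw [e]
    calc y ^ (-s.re - 2) * (B - y) ≤ y ^ (-s.re - 2) * 1 := by
          refine mul_le_mul_of_nonneg_left (by linarith [hy.1]) (by positivity)
      _ ≤ A ^ (-s.re - 2) := by
          rw [mul_one]; exact Real.rpow_le_rpow_of_nonpos hA hy.1 (by linarith)

/-- The corrected summand. -/
noncomputable def lfT (x : ℝ) (k : ℕ) (s : ℂ) : ℂ :=
  (((k + x : ℝ)) : ℂ) ^ (-s) - ((k + 1 : ℝ) : ℂ) ^ (-s)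
    + s * (x - 1) * ((k + 1 : ℝ) : ℂ) ^ (-s - 1)

def lfU : Set ℂ := {s | -(1/2) < s.re} ∩ Metric.ball 0 3

lemma lfU_open : IsOpen lfU :=
  (isOpen_lt continuous_const Complex.continuous_re).inter Metric.isOpen_ball

lemma lfU_conv : Convex ℝ lfU :=
  (convex_halfSpace_re_gt _).inter (convex_ball _ _)

lemma lfT_bound {x : ℝ} (hx : 0 < x) (hx1 : x ≤ 1) (k : ℕ) {s : ℂ} (hs : s ∈ lfU) :
    ‖lfT x k s‖ ≤ 12 * x ^ (-(7/2) : ℝ) * (1 / |(k : ℝ) + x| ^ (3/2 : ℝ)) := by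
  obtain ⟨h1, h2⟩ := hs
  simp only [Set.mem_ofPred_eq] at h1
  have h2' : ‖s‖ < 3 := by simpa using h2
  have hk : 0 < (k : ℝ) + x := by positivity
  have := lf_taylor s (by linarith) (A := k + x) (B := k + 1) hk (by linarith) (by linarith)
  have e : lfT x k s = (((k + x : ℝ)) : ℂ) ^ (-s) - ((k + 1 : ℝ) : ℂ) ^ (-s)
    + s * (((k + x : ℝ)) - ((k + 1 : ℝ) : ℂ)) * ((k + 1 : ℝ) : ℂ) ^ (-s - 1) := by
    rw [lfT]; push_cast; ring
  rw [e]
  refine this.trans ?_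
  have h3 : ‖s + 1‖ ≤ 4 := (norm_add_le _ _).trans (by simp; linarith)
  have h4 : ‖s‖ * ‖s + 1‖ ≤ 12 := by
    nlinarith [norm_nonneg s, norm_nonneg (s+1)]
  have h5 : (k + x) ^ (-s.re - 2) ≤ x ^ (-(7/2) : ℝ) * (1 / |(k : ℝ) + x| ^ (3/2 : ℝ)) := by
    rw [abs_of_pos hk, one_div, ← Real.rpow_neg hk.le,
      show -s.re - 2 = (-s.re - 1/2) + (-(3/2)) by ring, Real.rpow_add hk]
    refine mul_le_mul_of_nonneg_right ?_ (by positivity)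
    calc (k + x) ^ (-s.re - 1/2) ≤ x ^ (-s.re - 1/2) :=
          Real.rpow_le_rpow_of_nonpos hx (by linarith [(Nat.cast_nonneg k : (0:ℝ) ≤ k)]) (by linarith)
      _ ≤ _ := Real.rpow_le_rpow_of_exponent_ge hx hx1 (by
          have := (abs_lt.1 ((Complex.abs_re_le_norm s).trans_lt h2')).2
          linarith)
  rw [mul_assoc 12]
  exact mul_le_mul h4 h5 (by positivity) (by norm_num)

lemma lfT_summable_bound {x : ℝ} :
    Summable (fun k : ℕ => 12 * x ^ (-(7/2) : ℝ) * (1 / |(k : ℝ) + x| ^ (3/2 : ℝ))) :=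
  Summable.mul_left _ ((Real.summable_one_div_nat_add_rpow x (3/2)).2 (by norm_num))

lemma lfT_hasDerivAt {x : ℝ} (hx : 0 < x) (k : ℕ) (s : ℂ) :
    HasDerivAt (lfT x k) (-(Real.log (k + x) : ℂ) * (((k + x : ℝ)) : ℂ) ^ (-s)
      + (Real.log (k + 1) : ℂ) * (((k + 1 : ℝ)) : ℂ) ^ (-s)
      + ((x - 1) * ((k + 1 : ℝ) : ℂ) ^ (-s - 1) +
        s * (x - 1) * (-(Real.log (k + 1) : ℂ) * ((k + 1 : ℝ) : ℂ) ^ (-s - 1)))) s := by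
  have hk : 0 < (k : ℝ) + x := by positivity
  have hk1 : 0 < (k : ℝ) + 1 := by positivity
  have A : ∀ (y : ℝ), 0 < y → ∀ c : ℂ, HasDerivAt (fun s : ℂ => (y : ℂ) ^ (-s + c))
      (-(Real.log y : ℂ) * (y : ℂ) ^ (-s + c)) s := by
    intro y hy c
    have := ((hasDerivAt_neg s).add_const c).const_cpow (c := (y : ℂ))
      (Or.inl (by exact_mod_cast hy.ne'))
    rw [Complex.ofReal_log hy.le]
    convert! this using 1
    ring
  have h1 := A _ hk 0
  have h2 := A _ hk1 0
  have h3 := A _ hk1 (-1)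
  simp only [add_zero, ← sub_eq_add_neg] at h1 h2 h3
  have h4 := ((hasDerivAt_id s).mul_const ((x : ℂ) - 1)).mul h3
  have := (h1.sub h2).add h4
  convert! this using 1
  simp

/-- Regularised Hurwitz zeta function. -/
noncomputable def lfZ (x : ℝ) (s : ℂ) : ℂ := ∑' k : ℕ, lfT x k s

lemma lfZ_diff {x : ℝ} (hx : 0 < x) (hx1 : x ≤ 1) : DifferentiableOn ℂ (lfZ x) lfU :=
  Complex.differentiableOn_tsum_of_summable_norm lfT_summable_bound
    (fun k s _ => (lfT_hasDerivAt hx k s).differentiableAt.differentiableWithinAt) lfU_open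
    (fun k _ hs => lfT_bound hx hx1 k hs)

lemma lfU_zero : (0 : ℂ) ∈ lfU := by
  simp [lfU]

lemma lfZ_zero (x : ℝ) : lfZ x 0 = 0 := by
  simp [lfZ, lfT]

lemma lf_logGamma {x : ℝ} (hx : 0 < x) :
    Filter.Tendsto (fun n : ℕ => ∑ k ∈ Finset.range (n + 1),
      (-Real.log (k + x) + Real.log (k + 1) + (x - 1) * (1 / (k + 1)))) Filter.atTop
      (nhds (Real.log (Real.Gamma x) + (x - 1) * Real.eulerMascheroniConstant)) := by
  have h1 := Real.BohrMollerup.tendsto_log_gamma hx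
  have h2 := (Real.tendsto_harmonic_sub_log.comp (Filter.tendsto_add_atTop_nat 1))
  have h3 : Filter.Tendsto (fun n : ℕ => Real.log ((n : ℝ) + 1) - Real.log n) Filter.atTop (nhds 0) :=
    Real.tendsto_log_nat_add_one_sub_log
  have h4 := (h1.add (h2.const_mul (x - 1))).add (h3.const_mul x)
  simp only [mul_zero, add_zero] at h4
  refine h4.congr fun n => ?_
  simp only [Real.BohrMollerup.logGammaSeq, Function.comp_apply, harmonic, Finset.sum_add_distrib,
    ← Finset.mul_sum, Finset.sum_neg_distrib]
  have h5 : ∑ k ∈ Finset.range (n + 1), Real.log ((k : ℝ) + 1)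
      = Real.log (n.factorial) + Real.log (n + 1) := by
    have : ∀ m : ℕ, ∑ k ∈ Finset.range m, Real.log ((k : ℝ) + 1) = Real.log (m.factorial) := by
      intro m
      induction m with
      | zero => simp
      | succ m ih =>
        rw [Finset.sum_range_succ, ih, Nat.factorial_succ]
        push_cast
        rw [Real.log_mul (by positivity) (by positivity)]
        ring
    rw [this, Nat.factorial_succ]
    push_cast
    rw [Real.log_mul (by positivity) (by positivity)]
    ring
  rw [h5]
  push_cast
  simp only [add_comm x, one_div]
  ring

lemma lfZ_deriv {x : ℝ} (hx : 0 < x) (hx1 : x ≤ 1) :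
    HasDerivAt (lfZ x)
      ((Real.log (Real.Gamma x) : ℂ) + (x - 1) * Real.eulerMascheroniConstant) 0 := by
  have hd := ((lfZ_diff hx hx1).differentiableAt (lfU_open.mem_nhds lfU_zero)).hasDerivAt
  have hs := Complex.hasSum_deriv_of_summable_norm (lfT_summable_bound (x := x))
    (fun k s _ => (lfT_hasDerivAt hx k s).differentiableAt.differentiableWithinAt) lfU_open
    (fun k _ hs => lfT_bound hx hx1 k hs) lfU_zero
  have h1 := (hs.tendsto_sum_nat).comp (Filter.tendsto_add_atTop_nat 1)
  have h2 := (Complex.continuous_ofReal.tendsto _).comp (lf_logGamma hx)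
  have h3 := tendsto_nhds_unique (h1.congr fun n => ?_) h2
  · change deriv (lfZ x) 0 = _ at h3
    rw [h3] at hd
    convert! hd using 1
    push_cast; ring
  · simp only [Function.comp_apply]
    push_cast
    refine Finset.sum_congr rfl fun k _ => ?_
    rw [(lfT_hasDerivAt hx k 0).deriv]
    simp [Complex.cpow_neg_one]

lemma lfZ_eq {x : ℝ} (hx : 0 < x) (hx1 : x ≤ 1) {s : ℂ} (hs : 1 < s.re) :
    lfZ x s = HurwitzZeta.hurwitzZeta (x : UnitAddCircle) s - riemannZeta s
      + s * (x - 1) * riemannZeta (s + 1) := by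
  have h1 := HurwitzZeta.hasSum_hurwitzZeta_of_one_lt_re ⟨hx.le, hx1⟩ hs
  have h2 := HurwitzZeta.hasSum_hurwitzZeta_of_one_lt_re (a := 1) (by simp) hs
  have h3 := HurwitzZeta.hasSum_hurwitzZeta_of_one_lt_re (a := 1) (by simp) (s := s + 1)
    (by simp; linarith)
  have e : ((1 : ℝ) : UnitAddCircle) = 0 := AddCircle.coe_period 1
  rw [e, HurwitzZeta.hurwitzZeta_zero] at h2 h3
  have h4 := ((h1.sub h2).add (h3.mul_left (s * (x - 1)))).tsum_eq
  rw [← h4, lfZ]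
  refine tsum_congr fun k => ?_
  rw [lfT, Complex.cpow_neg, Complex.cpow_neg, show -s - 1 = -(s+1) by ring, Complex.cpow_neg]
  push_cast
  simp only [one_div]

/-- `s ζ(s+1)` with removable singularity removed. -/
noncomputable def lfPsi : ℂ → ℂ := Function.update (fun s => s * riemannZeta (s + 1)) 0 1

lemma lfPsi_deriv : HasDerivAt lfPsi Real.eulerMascheroniConstant 0 := by
  rw [hasDerivAt_iff_tendsto_slope]
  have h := tendsto_riemannZeta_sub_one_div
  have h2 : Filter.Tendsto (fun s : ℂ => s + 1) (nhdsWithin 0 {0}ᶜ) (nhdsWithin 1 {1}ᶜ) := by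
    refine tendsto_nhdsWithin_iff.2 ⟨?_, ?_⟩
    · have : Filter.Tendsto (fun s : ℂ => s + 1) (nhds 0) (nhds (0 + 1)) :=
        Continuous.tendsto (by fun_prop) 0
      rw [zero_add] at this
      exact this.mono_left nhdsWithin_le_nhds
    · filter_upwards [self_mem_nhdsWithin] with s hs
      simpa using hs
  refine (h.comp h2).congr' ?_
  filter_upwards [self_mem_nhdsWithin] with s hs
  have hs' : s ≠ 0 := hs
  simp [slope_def_field, lfPsi, hs']
  field_simp

lemma lfPsi_diff : Differentiable ℂ lfPsi := by
  intro s
  by_cases hs : s = 0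
  · subst hs; exact lfPsi_deriv.differentiableAt
  · have : DifferentiableAt ℂ (fun s => s * riemannZeta (s + 1)) s := by
      refine differentiableAt_id.mul ?_
      refine (differentiableAt_riemannZeta (s := s + 1) (by simpa using hs)).comp s
        (f := fun s => s + 1) (by fun_prop)
    refine this.congr_of_eventuallyEq ?_
    filter_upwards [isOpen_ne.mem_nhds hs] with z hz
    simp [lfPsi, Function.update_of_ne hz]

lemma lf_main {d : ℕ} [NeZero d] (χ : DirichletCharacter ℂ d) (hχ : χ ≠ 1) (hd : 1 < d) :
    DirichletCharacter.LFunction χ 0 = - ∑ a ∈ Finset.Ioo 0 d, χ (a : ZMod d) * ((a : ℂ) / d) ∧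
    deriv (DirichletCharacter.LFunction χ) 0 =
      - Real.log d * DirichletCharacter.LFunction χ 0 +
      ∑ a ∈ Finset.Ioo 0 d, χ (a : ZMod d) * (Real.log (Real.Gamma (a / d)) : ℂ) := by
  have hd0 : (d : ℂ) ≠ 0 := by exact_mod_cast (NeZero.ne d)
  have hdR : (0:ℝ) < d := by exact_mod_cast (NeZero.pos d)
  have hsum : ∀ g : ZMod d → ℂ, ∑ j, χ j * g j
      = ∑ a ∈ Finset.Ioo 0 d, χ (a : ZMod d) * g (a : ZMod d) := by
    intro g
    have h0 : χ (0 : ZMod d) = 0 := by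
      apply MulChar.map_nonunit
      have : Fact (1 < d) := ⟨hd⟩
      simp
    symm
    refine Finset.sum_bij_ne_zero (fun a _ _ => (a : ZMod d)) (by simp) ?_ ?_ (by simp)
    · intro a ha _ b hb _ hab
      simp only [Finset.mem_Ioo] at ha hb
      have := congrArg ZMod.val hab
      rwa [ZMod.val_natCast_of_lt ha.2, ZMod.val_natCast_of_lt hb.2] at this
    · intro j _ hj
      refine ⟨j.val, ?_, ?_, by simp⟩
      · simp only [Finset.mem_Ioo]
        refine ⟨Nat.pos_of_ne_zero fun h => hj ?_, ZMod.val_lt j⟩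
        rw [(ZMod.val_eq_zero j).1 h, h0, zero_mul]
      · simpa using hj
  have hsum0 : ∑ a ∈ Finset.Ioo 0 d, χ (a : ZMod d) = 0 := by
    have := hsum (fun _ => 1)
    simp only [mul_one] at this
    rw [← this]; exact χ.sum_eq_zero_of_ne_one hχ
  have hx : ∀ a ∈ Finset.Ioo 0 d, (0:ℝ) < a / d ∧ (a / d : ℝ) ≤ 1 := by
    intro a ha
    simp only [Finset.mem_Ioo] at ha
    have h1 : (0:ℝ) < a := by exact_mod_cast ha.1
    have h2 : (a:ℝ) ≤ d := by exact_mod_cast ha.2.le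
    exact ⟨by positivity, (div_le_one hdR).2 h2⟩
  set c : ℂ := ∑ a ∈ Finset.Ioo 0 d, χ (a : ZMod d) * ((a : ℂ) / d) with hc
  have hc' : ∑ a ∈ Finset.Ioo 0 d, χ (a : ZMod d) * (((a / d : ℝ) : ℂ) - 1) = c := by
    simp only [mul_sub, mul_one, Finset.sum_sub_distrib, hsum0, sub_zero, hc]
    push_cast; rfl
  let F : ℂ → ℂ := fun s => (d : ℂ) ^ s * DirichletCharacter.LFunction χ s
  let G : ℂ → ℂ := fun s => ∑ a ∈ Finset.Ioo 0 d, χ (a : ZMod d) * lfZ (a / d) s - c * lfPsi s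
  have hpow : Differentiable ℂ (fun s : ℂ => (d : ℂ) ^ s) := fun s =>
    (hasDerivAt_id s).const_cpow (Or.inl hd0) |>.differentiableAt
  have hF : DifferentiableOn ℂ F lfU := (hpow.mul
    (DirichletCharacter.differentiable_LFunction hχ)).differentiableOn
  have hG : DifferentiableOn ℂ G lfU := by
    refine DifferentiableOn.sub (DifferentiableOn.fun_sum fun a ha => ?_)
      (lfPsi_diff.differentiableOn.const_mul c)
    exact (lfZ_diff (hx a ha).1 (hx a ha).2).const_mul _
  have hFG : ∀ s : ℂ, 1 < s.re → F s = G s := by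
    intro s hs
    have hs0 : s ≠ 0 := by rintro rfl; norm_num at hs
    simp only [F, G, DirichletCharacter.LFunction, ZMod.LFunction]
    rw [← mul_assoc, ← Complex.cpow_add _ _ hd0, add_neg_cancel, Complex.cpow_zero, one_mul, hsum]
    have : ∀ a ∈ Finset.Ioo 0 d, χ (a : ZMod d) * lfZ (a / d) s =
        χ (a : ZMod d) * HurwitzZeta.hurwitzZeta (ZMod.toAddCircle (a : ZMod d)) s
        - χ (a : ZMod d) * riemannZeta s
        + (χ (a : ZMod d) * (((a / d : ℝ) : ℂ) - 1)) * (s * riemannZeta (s + 1)) := by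
      intro a ha
      rw [lfZ_eq (hx a ha).1 (hx a ha).2 hs, ZMod.toAddCircle_apply,
        ZMod.val_natCast_of_lt (Finset.mem_Ioo.1 ha).2]
      ring
    rw [Finset.sum_congr rfl this, Finset.sum_add_distrib, Finset.sum_sub_distrib,
      ← Finset.sum_mul, ← Finset.sum_mul, hsum0, hc', lfPsi, Function.update_of_ne hs0]
    ring
  have hEq : Set.EqOn F G lfU := by
    have h2 : (2 : ℂ) ∈ lfU := by
      simp [lfU]; norm_num
    refine (hF.analyticOnNhd lfU_open).eqOn_of_preconnected_of_eventuallyEq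
      (hG.analyticOnNhd lfU_open) lfU_conv.isPreconnected h2 ?_
    filter_upwards [(isOpen_lt continuous_const Complex.continuous_re).mem_nhds
      (show (1:ℝ) < (2:ℂ).re by simp)] with s hs
    exact hFG s hs
  have h0 : DirichletCharacter.LFunction χ 0 = - c := by
    have := hEq lfU_zero
    simpa [F, G, lfZ_zero, lfPsi] using this
  refine ⟨h0, ?_⟩
  have hGd : HasDerivAt G (∑ a ∈ Finset.Ioo 0 d, χ (a : ZMod d) *
      ((Real.log (Real.Gamma (a / d : ℝ)) : ℂ) + (((a / d : ℝ) : ℂ) - 1) *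
        Real.eulerMascheroniConstant) - c * Real.eulerMascheroniConstant) 0 := by
    refine HasDerivAt.sub (HasDerivAt.fun_sum fun a ha => ?_) (lfPsi_deriv.const_mul c)
    exact (lfZ_deriv (hx a ha).1 (hx a ha).2).const_mul _
  have hFd : HasDerivAt F ((d : ℂ) ^ (0:ℂ) * Complex.log d * 1 * DirichletCharacter.LFunction χ 0
      + (d : ℂ) ^ (0:ℂ) * deriv (DirichletCharacter.LFunction χ) 0) 0 :=
    ((hasDerivAt_id (0:ℂ)).const_cpow (Or.inl hd0)).mul
      (DirichletCharacter.differentiable_LFunction hχ 0).hasDerivAt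
  have hu := hFd.unique (hGd.congr_of_eventuallyEq
    (hEq.eventuallyEq_of_mem (lfU_open.mem_nhds lfU_zero)))
  simp only [mul_add, Finset.sum_add_distrib, ← mul_assoc, ← Finset.sum_mul, hc'] at hu
  rw [Complex.cpow_zero, ← Complex.natCast_log] at hu
  linear_combination hu
/-- theta error term -/
noncomputable def lfDelta (y : ℝ) : ℝ := HurwitzZeta.cosKernel 0 y - 1

lemma lfDelta_bound (u : ℝ) {y : ℝ} (hy : 0 < y) :
    |HurwitzZeta.cosKernel (u : UnitAddCircle) y - 1| ≤ lfDelta y := by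
  have h1 := HurwitzZeta.hasSum_nat_cosKernel₀ u hy
  have h2 := HurwitzZeta.hasSum_nat_cosKernel₀ 0 hy
  have h3 : HurwitzZeta.cosKernel ((0:ℝ) : UnitAddCircle) y - 1 = lfDelta y := by
    rw [lfDelta]; simp
  rw [h3] at h2
  have hb : ∀ n : ℕ, |2 * Real.cos (2 * Real.pi * u * (n + 1)) * Real.exp (-Real.pi * (n + 1) ^ 2 * y)|
      ≤ 2 * Real.cos (2 * Real.pi * 0 * (n + 1)) * Real.exp (-Real.pi * (n + 1) ^ 2 * y) := by
    intro n
    rw [abs_mul, abs_mul, Real.abs_exp]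
    refine mul_le_mul_of_nonneg_right ?_ (Real.exp_pos _).le
    simp only [mul_zero, zero_mul, Real.cos_zero]
    have := Real.abs_cos_le_one (2 * Real.pi * u * (n + 1))
    rw [abs_two]; linarith
  rw [← h1.tsum_eq, ← Real.norm_eq_abs]
  exact tsum_of_norm_bounded h2 hb

lemma lfDelta_nonneg {y : ℝ} (hy : 0 < y) : 0 ≤ lfDelta y :=
  (abs_nonneg _).trans (lfDelta_bound 0 hy)

lemma lfDelta_tendsto : Filter.Tendsto (fun y => y * lfDelta y) Filter.atTop (nhds 0) := by
  obtain ⟨p, hp, h⟩ := HurwitzZeta.isBigO_atTop_cosKernel_sub 0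
  have h2 : Filter.Tendsto (fun y : ℝ => y * Real.exp (-p * y)) Filter.atTop (nhds 0) := by
    have := ((Real.tendsto_pow_mul_exp_neg_atTop_nhds_zero 1).comp
      (Filter.tendsto_id.const_mul_atTop hp)).const_mul p⁻¹
    rw [mul_zero] at this
    refine this.congr fun y => ?_
    simp only [Function.comp_apply, id, pow_one, neg_mul]
    field_simp
  exact ((Asymptotics.isBigO_refl (fun y : ℝ => y) _).mul h).trans_tendsto h2

lemma lfDelta_tendsto' : Filter.Tendsto lfDelta Filter.atTop (nhds 0) := by
  refine squeeze_zero' ?_ ?_ lfDelta_tendsto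
  · filter_upwards [Filter.eventually_gt_atTop 0] with y hy using lfDelta_nonneg hy
  · filter_upwards [Filter.eventually_ge_atTop 1] with y hy
    exact le_mul_of_one_le_left (lfDelta_nonneg (by linarith)) hy

lemma lf_even_bound (u : ℝ) {t : ℝ} (ht : 0 < t) :
    |HurwitzZeta.evenKernel (u : UnitAddCircle) t - 1 / t ^ (1/2 : ℝ)|
      ≤ 1 / t ^ (1/2 : ℝ) * lfDelta (1 / t) := by
  rw [HurwitzZeta.evenKernel_functional_equation, ← mul_sub_one, abs_mul,
    abs_of_nonneg (by positivity)]
  exact mul_le_mul_of_nonneg_left (lfDelta_bound u (by positivity)) (by positivity)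

lemma lf_theta_row {A D : ℝ} (hA : 0 < A) (u : ℝ) {x : ℝ} (hx : 0 < x) (n : ℤ) :
    HasSum (fun m : ℤ => Real.exp (-x * (A * (m + u * n) ^ 2 + D * n ^ 2)))
      (Real.exp (-Real.pi * (n + 0) ^ 2 * (x * D / Real.pi)) *
        HurwitzZeta.evenKernel ((u * n : ℝ) : UnitAddCircle) (x * A / Real.pi)) := by
  have h := (HurwitzZeta.hasSum_int_evenKernel (u * n) (t := x * A / Real.pi)
    (by positivity)).mul_left (Real.exp (-Real.pi * (n + 0) ^ 2 * (x * D / Real.pi)))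
  convert! h using 1
  ext m
  rw [← Real.exp_add]
  congr 1
  field_simp
  ring

lemma lf_theta_summable {A D : ℝ} (hA : 0 < A) (hD : 0 < D) (u : ℝ) {x : ℝ} (hx : 0 < x) :
    Summable (fun p : ℤ × ℤ => Real.exp (-x * (A * (p.2 + u * p.1) ^ 2 + D * p.1 ^ 2))) := by
  rw [summable_prod_of_nonneg (fun p => (Real.exp_pos _).le)]
  refine ⟨fun n => (lf_theta_row hA u hx n).summable, ?_⟩
  have ht : 0 < x * A / Real.pi := by positivity
  have hs : 0 < x * D / Real.pi := by positivity
  simp only [fun n => (lf_theta_row (D := D) hA u hx n).tsum_eq]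
  refine Summable.of_norm_bounded (g := fun n : ℤ =>
    Real.exp (-Real.pi * (n + 0) ^ 2 * (x * D / Real.pi)) *
      (1 / (x * A / Real.pi) ^ (1/2 : ℝ) + 1 / (x * A / Real.pi) ^ (1/2 : ℝ) *
        lfDelta (1 / (x * A / Real.pi)))) ?_ ?_
  · exact (HurwitzZeta.hasSum_int_evenKernel 0 hs).summable.mul_right _
  · intro n
    rw [norm_mul, Real.norm_eq_abs, Real.abs_exp]
    refine mul_le_mul_of_nonneg_left ?_ (Real.exp_pos _).le
    have := lf_even_bound (u * n) ht
    have h0 : 0 < 1 / (x * A / Real.pi) ^ (1/2 : ℝ) := by positivity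
    rw [Real.norm_eq_abs]
    rw [abs_le] at this ⊢
    constructor <;> linarith

lemma lf_theta_bound {A D : ℝ} (hA : 0 < A) (hD : 0 < D) (u : ℝ) {x : ℝ} (hx : 0 < x) :
    |(∑' p : ℤ × ℤ, Real.exp (-x * (A * (p.2 + u * p.1) ^ 2 + D * p.1 ^ 2)))
      - 1 / (x * A / Real.pi) ^ (1/2 : ℝ) * (1 / (x * D / Real.pi) ^ (1/2 : ℝ))|
      ≤ 1 / (x * A / Real.pi) ^ (1/2 : ℝ) * (1 / (x * D / Real.pi) ^ (1/2 : ℝ)) *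
        (lfDelta (1 / (x * A / Real.pi)) * (1 + lfDelta (1 / (x * D / Real.pi)))
          + lfDelta (1 / (x * D / Real.pi))) := by
  have ht : 0 < x * A / Real.pi := by positivity
  have hs : 0 < x * D / Real.pi := by positivity
  rw [(lf_theta_summable hA hD u hx).tsum_prod' (fun n => (lf_theta_row hA u hx n).summable)]
  simp only [fun n => (lf_theta_row (D := D) hA u hx n).tsum_eq]
  set t := x * A / Real.pi
  set s := x * D / Real.pi
  have h1 := HurwitzZeta.hasSum_int_evenKernel 0 hs
  set θ := HurwitzZeta.evenKernel ((0:ℝ) : UnitAddCircle) s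
  set P := 1 / t ^ (1/2 : ℝ)
  set R := 1 / s ^ (1/2 : ℝ)
  have hP : 0 < P := by positivity
  have hR : 0 < R := by positivity
  have hb : ∀ n : ℤ, ‖Real.exp (-Real.pi * (n + 0) ^ 2 * s) *
      HurwitzZeta.evenKernel ((u * n : ℝ) : UnitAddCircle) t
      - Real.exp (-Real.pi * (n + 0) ^ 2 * s) * P‖ ≤
      Real.exp (-Real.pi * (n + 0) ^ 2 * s) * (P * lfDelta (1 / t)) := by
    intro n
    rw [← mul_sub, norm_mul, Real.norm_eq_abs, Real.abs_exp]
    exact mul_le_mul_of_nonneg_left (lf_even_bound (u * n) ht) (Real.exp_pos _).le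
  have h2 := tsum_of_norm_bounded (h1.mul_right (P * lfDelta (1/t))) hb
  have hsum : Summable (fun n : ℤ => Real.exp (-Real.pi * (n + 0) ^ 2 * s) *
      HurwitzZeta.evenKernel ((u * n : ℝ) : UnitAddCircle) t) := by
    have := (Summable.of_norm_bounded (h1.mul_right (P * lfDelta (1/t))).summable hb).add
      (h1.mul_right P).summable
    simpa using this
  rw [hsum.tsum_sub (h1.mul_right P).summable, (h1.mul_right P).tsum_eq] at h2
  have h3 : |θ - R| ≤ R * lfDelta (1/s) := lf_even_bound 0 hs
  have h3' : θ ≤ R * (1 + lfDelta (1/s)) := by linarith [(abs_le.1 h3).2]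
  have hd := lfDelta_nonneg (y := 1/t) (by positivity)
  have h4 : θ * (P * lfDelta (1/t)) ≤ R * (1 + lfDelta (1/s)) * (P * lfDelta (1/t)) :=
    mul_le_mul_of_nonneg_right h3' (by positivity)
  have h5 : |θ * P - P * R| ≤ P * (R * lfDelta (1/s)) := by
    rw [mul_comm θ, ← mul_sub, abs_mul, abs_of_pos hP]
    exact mul_le_mul_of_nonneg_left h3 hP.le
  refine (abs_sub_le _ (θ * P) _).trans ?_
  rw [Real.norm_eq_abs] at h2
  linarith

lemma lf_theta {A D : ℝ} (hA : 0 < A) (hD : 0 < D) (u : ℝ) :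
    ∃ K : ℝ, Filter.Tendsto (fun x : ℝ =>
      (∑' p : ℤ × ℤ, Real.exp (-x * (A * (p.2 + u * p.1) ^ 2 + D * p.1 ^ 2))) - K / x)
      (nhdsWithin 0 (Set.Ioi 0)) (nhds 0) := by
  refine ⟨1 / (A / Real.pi) ^ (1/2 : ℝ) * (1 / (D / Real.pi) ^ (1/2 : ℝ)), ?_⟩
  set K := 1 / (A / Real.pi) ^ (1/2 : ℝ) * (1 / (D / Real.pi) ^ (1/2 : ℝ)) with hK
  have hKx : ∀ x : ℝ, 0 < x → 1 / (x * A / Real.pi) ^ (1/2 : ℝ) * (1 / (x * D / Real.pi) ^ (1/2 : ℝ))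
      = K / x := by
    intro x hx
    rw [hK, mul_div_assoc, mul_div_assoc, Real.mul_rpow hx.le (by positivity),
      Real.mul_rpow hx.le (by positivity)]
    have : x ^ (1/2 : ℝ) * x ^ (1/2 : ℝ) = x := by
      rw [← Real.rpow_add hx]; norm_num
    field_simp
    rw [sq, this]
  have hat : ∀ a : ℝ, 0 < a → Filter.Tendsto (fun x : ℝ => 1 / (x * a / Real.pi))
      (nhdsWithin 0 (Set.Ioi 0)) Filter.atTop := by
    intro a ha
    have := (tendsto_inv_nhdsGT_zero (𝕜 := ℝ)).const_mul_atTop (show 0 < Real.pi / a by positivity)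
    refine this.congr fun x => ?_
    field_simp
  have hx1 : ∀ a : ℝ, 0 < a → Filter.Tendsto (fun x : ℝ => K / x * lfDelta (1 / (x * a / Real.pi)))
      (nhdsWithin 0 (Set.Ioi 0)) (nhds 0) := by
    intro a ha
    have := (lfDelta_tendsto.comp (hat a ha)).const_mul (K * a / Real.pi)
    rw [mul_zero] at this
    refine this.congr fun x => ?_
    simp only [Function.comp_apply]
    field_simp
  have hlim : Filter.Tendsto (fun x : ℝ => K / x * lfDelta (1 / (x * A / Real.pi))
      * (1 + lfDelta (1 / (x * D / Real.pi))) + K / x * lfDelta (1 / (x * D / Real.pi)))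
      (nhdsWithin 0 (Set.Ioi 0)) (nhds 0) := by
    have := ((hx1 A hA).mul ((lfDelta_tendsto'.comp (hat D hD)).const_add 1)).add (hx1 D hD)
    simpa using this
  refine squeeze_zero_norm' ?_ hlim
  filter_upwards [self_mem_nhdsWithin] with x hx
  have := lf_theta_bound hA hD u hx
  rw [hKx x hx] at this
  rw [Real.norm_eq_abs]
  refine this.trans (le_of_eq ?_)
  ring

/-- Positive definite form version. -/
lemma lf_theta_form {A B C : ℝ} (hA : 0 < A) (hD : B ^ 2 < 4 * A * C) :
    (∀ x : ℝ, 0 < x → Summable (fun p : ℤ × ℤ =>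
      Real.exp (-x * (A * p.2 ^ 2 + B * p.2 * p.1 + C * p.1 ^ 2)))) ∧
    ∃ K : ℝ, Filter.Tendsto (fun x : ℝ =>
      (∑' p : ℤ × ℤ, Real.exp (-x * (A * p.2 ^ 2 + B * p.2 * p.1 + C * p.1 ^ 2))) - K / x)
      (nhdsWithin 0 (Set.Ioi 0)) (nhds 0) := by
  have e : ∀ p : ℤ × ℤ, A * (p.2 : ℝ) ^ 2 + B * p.2 * p.1 + C * p.1 ^ 2
      = A * (p.2 + B / (2 * A) * p.1) ^ 2 + ((4 * A * C - B ^ 2) / (4 * A)) * p.1 ^ 2 := by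
    intro p; field_simp; ring
  have hD' : 0 < (4 * A * C - B ^ 2) / (4 * A) := div_pos (by linarith) (by linarith)
  simp only [e]
  exact ⟨fun x hx => lf_theta_summable hA hD' _ hx, lf_theta hA hD' _⟩
/-- `1/(e^y+1)` -/
noncomputable def lfEta (y : ℝ) : ℝ := 1 / (Real.exp y + 1)

lemma lfEta_pos (y : ℝ) : 0 < lfEta y := by unfold lfEta; positivity

lemma lfEta_hasDeriv (y : ℝ) :
    HasDerivAt lfEta (-(Real.exp y / (Real.exp y + 1) ^ 2)) y := by
  have h : Real.exp y + 1 ≠ 0 := by positivity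
  have := ((Real.hasDerivAt_exp y).add_const 1).inv h
  unfold lfEta
  simp only [one_div]
  convert! this using 1
  ring

lemma lfEta_convex : ConvexOn ℝ (Set.Ici 0) lfEta := by
  refine MonotoneOn.convexOn_of_deriv (convex_Ici 0)
    (fun y _ => (lfEta_hasDeriv y).continuousAt.continuousWithinAt)
    (fun y _ => (lfEta_hasDeriv y).differentiableAt.differentiableWithinAt) ?_
  intro a ha b hb hab
  rw [interior_Ici] at ha hb
  rw [(lfEta_hasDeriv a).deriv, (lfEta_hasDeriv b).deriv, neg_le_neg_iff,
    div_le_div_iff₀ (by positivity) (by positivity)]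
  have h1 : 1 < Real.exp a := Real.one_lt_exp_iff.2 ha
  have h2 : Real.exp a ≤ Real.exp b := Real.exp_le_exp.2 hab
  set p := Real.exp a
  set q := Real.exp b
  have : 0 ≤ (q - p) * (p * q - 1) := mul_nonneg (by linarith) (by nlinarith)
  nlinarith

lemma lfEta_le (y : ℝ) : lfEta y ≤ Real.exp (-y) := by
  rw [lfEta, Real.exp_neg, ← one_div]
  exact one_div_le_one_div_of_le (Real.exp_pos _) (by linarith)

lemma lf_summable_exp {x : ℝ} (hx : 0 < x) (b : ℝ) :
    Summable (fun k : ℕ => Real.exp (-(b + k * x))) := by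
  have h : ∀ k : ℕ, Real.exp (-(b + k * x)) = Real.exp (-b) * Real.exp (-x) ^ k := by
    intro k
    rw [← Real.exp_nat_mul, ← Real.exp_add]; congr 1; ring
  simp only [h]
  exact (summable_geometric_of_lt_one (Real.exp_pos _).le (by simpa using hx)).mul_left _

lemma lfEta_summable {x : ℝ} (hx : 0 < x) (b : ℝ) :
    Summable (fun k : ℕ => lfEta (b + k * x)) :=
  Summable.of_nonneg_of_le (fun k => (lfEta_pos _).le) (fun k => lfEta_le _) (lf_summable_exp hx b)

lemma lfEta_slope {y h t : ℝ} (hy : 0 ≤ y) (hh : 0 < h) (ht : 0 ≤ t) (ht1 : t ≤ 1) :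
    lfEta (y + t * h) - lfEta y ≤ t * (lfEta (y + h) - lfEta y) := by
  have := lfEta_convex.2 (show y ∈ Set.Ici (0:ℝ) from hy)
    (show y + h ∈ Set.Ici (0:ℝ) by simp only [Set.mem_Ici]; linarith)
    (show 0 ≤ 1 - t by linarith) ht (by ring)
  simp only [smul_eq_mul] at this
  rw [show (1 - t) * y + t * (y + h) = y + t * h by ring] at this
  linarith

lemma lfEta_slope' {y h t : ℝ} (hy : 0 ≤ y) (hh : 0 < h) (ht : 0 ≤ t) (ht1 : t ≤ 1) :
    t * (lfEta (y + h) - lfEta y) ≤ lfEta (y + h + t * h) - lfEta (y + h) := by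
  have := lfEta_convex.2 (show y ∈ Set.Ici (0:ℝ) from hy)
    (show y + h + t * h ∈ Set.Ici (0:ℝ) by simp only [Set.mem_Ici]; positivity)
    (show 0 ≤ t / (1 + t) by positivity) (show 0 ≤ 1 / (1 + t) by positivity)
    (by field_simp; ring)
  simp only [smul_eq_mul] at this
  rw [show t / (1 + t) * y + 1 / (1 + t) * (y + h + t * h) = y + h by field_simp; ring] at this
  have h2 : (1 + t) * lfEta (y + h) ≤ t * lfEta y + lfEta (y + h + t * h) := by
    calc (1 + t) * lfEta (y + h) ≤ (1 + t) * (t / (1 + t) * lfEta y + 1 / (1 + t) * lfEta (y + h + t * h)) :=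
          mul_le_mul_of_nonneg_left this (by positivity)
      _ = _ := by field_simp
  linarith

lemma lfEta_tele {h : ℝ} (hh : 0 < h) (b : ℝ) :
    HasSum (fun k : ℕ => lfEta (b + k * h + h) - lfEta (b + k * h)) (-lfEta b) := by
  have h1 := (lfEta_summable hh b)
  have h2 := (summable_nat_add_iff (f := fun k : ℕ => lfEta (b + k * h)) 1).2 h1
  have h3 : ∀ k : ℕ, lfEta (b + ((k + 1 : ℕ) : ℝ) * h) = lfEta (b + k * h + h) := by
    intro k; push_cast; congr 1; ring
  have h4 := h1.tsum_eq_zero_add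
  simp only [h3] at h2 h4
  have h5 := h2.hasSum.sub h1.hasSum
  rw [h4] at h5
  simpa using h5

lemma lfEta_diff_bounds {h t : ℝ} (hh : 0 < h) (ht : 0 ≤ t) (ht1 : t ≤ 1) :
    (lfEta (t * h) - lfEta 0) - t * lfEta 0 ≤
      (∑' k : ℕ, lfEta (t * h + k * h)) - ∑' k : ℕ, lfEta (0 + k * h) ∧
    (∑' k : ℕ, lfEta (t * h + k * h)) - ∑' k : ℕ, lfEta (0 + k * h) ≤ - t * lfEta 0 := by
  have s1 := lfEta_summable hh (t * h)
  have s0 := lfEta_summable hh 0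
  rw [← s1.tsum_sub s0]
  have hT := (lfEta_tele hh 0).mul_left t
  constructor
  · rw [(s1.sub s0).tsum_eq_zero_add]
    have s2 := (summable_nat_add_iff 1).2 (s1.sub s0)
    have : t * -lfEta 0 ≤ _ := hasSum_le (fun k => ?_) hT s2.hasSum
    · simp only [Nat.cast_zero, zero_mul, add_zero]
      push_cast at this ⊢
      linarith
    · have := lfEta_slope' (y := 0 + k * h) (by positivity) hh ht ht1
      refine this.trans (le_of_eq ?_)
      push_cast
      congr 2 <;> ring
  · have : _ ≤ t * -lfEta 0 := hasSum_le (fun k => ?_) (s1.sub s0).hasSum hT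
    · linarith
    · have := lfEta_slope (y := 0 + k * h) (by positivity) hh ht ht1
      refine le_trans (le_of_eq ?_) this
      congr 2; ring

lemma lfEta_lim (d : ℕ) (hd : 0 < d) (a : ℕ) (ha : a ≤ d) :
    Filter.Tendsto (fun x : ℝ => (∑' k : ℕ, lfEta ((a + d * k : ℕ) * x))
      - ∑' k : ℕ, lfEta ((d * k : ℕ) * x)) (nhdsWithin 0 (Set.Ioi 0)) (nhds (-(a / d) / 2)) := by
  have hdR : (0:ℝ) < d := by exact_mod_cast hd
  have hb : ∀ x : ℝ, 0 < x → _ := fun x hx => lfEta_diff_bounds (h := d * x) (t := a / d)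
    (by positivity) (by positivity) ((div_le_one hdR).2 (by exact_mod_cast ha))
  have e1 : ∀ (k : ℕ) (x : ℝ), (a : ℝ) / d * (d * x) + k * (d * x) = (a + d * k : ℕ) * x := by
    intro k x; push_cast; field_simp
  have e2 : ∀ (k : ℕ) (x : ℝ), 0 + k * (d * x) = (d * k : ℕ) * x := by
    intro k x; push_cast; ring
  simp only [e1, e2] at hb
  have h0 : lfEta 0 = 1 / 2 := by simp [lfEta]; norm_num
  have hc : Filter.Tendsto (fun x : ℝ => (lfEta ((a : ℝ) / d * (d * x)) - lfEta 0) - a / d * lfEta 0)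
      (nhdsWithin 0 (Set.Ioi 0)) (nhds (-(a / d) / 2)) := by
    have : Continuous lfEta := continuous_iff_continuousAt.2 fun y => (lfEta_hasDeriv y).continuousAt
    have h2 : Filter.Tendsto (fun x : ℝ => (lfEta ((a : ℝ) / d * (d * x)) - lfEta 0) - a / d * lfEta 0)
      (nhds 0) (nhds ((lfEta ((a : ℝ) / d * (d * 0)) - lfEta 0) - a / d * lfEta 0)) :=
      Continuous.tendsto (by fun_prop) 0
    simp only [mul_zero, sub_self, h0] at h2
    rw [show (-((a:ℝ) / d) / 2) = 0 - a / d * (1/2) by ring, h0]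
    exact h2.mono_left nhdsWithin_le_nhds
  refine tendsto_of_tendsto_of_tendsto_of_le_of_le' hc tendsto_const_nhds ?_ ?_
  · filter_upwards [self_mem_nhdsWithin] with x hx using (hb x hx).1
  · filter_upwards [self_mem_nhdsWithin] with x hx
    refine (hb x hx).2.trans (le_of_eq ?_)
    rw [h0]; ring

lemma lf_char_lim {d : ℕ} [NeZero d] (χ : DirichletCharacter ℂ d) (hχ : χ ≠ 1) :
    Filter.Tendsto (fun x : ℝ => ∑' m : ℕ, χ (m : ZMod d) * (lfEta (m * x) : ℂ))
      (nhdsWithin 0 (Set.Ioi 0)) (nhds (∑ j : ZMod d, χ j * (-((j.val : ℂ) / d) / 2))) := by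
  have hd : 0 < d := NeZero.pos d
  have hdR : (0:ℝ) < d := by exact_mod_cast hd
  have key : Filter.Tendsto (fun x : ℝ => ∑ j : ZMod d, χ j *
      (((∑' k : ℕ, lfEta ((j.val + d * k : ℕ) * x)) - ∑' k : ℕ, lfEta ((d * k : ℕ) * x) : ℝ) : ℂ))
      (nhdsWithin 0 (Set.Ioi 0)) (nhds (∑ j : ZMod d, χ j * (-((j.val : ℂ) / d) / 2))) := by
    refine tendsto_finsetSum _ fun j _ => Filter.Tendsto.const_mul _ ?_
    have := (Complex.continuous_ofReal.tendsto _).comp (lfEta_lim d hd j.val (ZMod.val_lt j).le)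
    refine this.congr' ?_ |>.trans (le_of_eq ?_)
    · exact Filter.Eventually.of_forall fun x => rfl
    · push_cast; rfl
  refine key.congr' ?_
  filter_upwards [self_mem_nhdsWithin] with x hx
  have hx : 0 < x := hx
  have hs : Summable (fun m : ℕ => χ (m : ZMod d) * (lfEta (m * x) : ℂ)) := by
    have := lfEta_summable hx 0
    simp only [zero_add] at this
    refine Summable.of_norm_bounded this fun m => ?_
    rw [norm_mul, Complex.norm_real, Real.norm_of_nonneg (lfEta_pos _).le]
    exact mul_le_of_le_one_left (lfEta_pos _).le (χ.norm_le_one _)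
  rw [Nat.sumByResidueClasses hs d]
  have : ∀ j : ZMod d, ∑' m : ℕ, χ ((j.val + d * m : ℕ) : ZMod d) *
      (lfEta ((j.val + d * m : ℕ) * x) : ℂ)
      = χ j * ((∑' k : ℕ, lfEta ((j.val + d * k : ℕ) * x) : ℝ) : ℂ) := by
    intro j
    rw [Complex.ofReal_tsum, ← tsum_mul_left]
    refine tsum_congr fun m => ?_
    congr 2
    simp
  simp only [this]
  simp only [Complex.ofReal_sub, mul_sub, Finset.sum_sub_distrib, ← Finset.sum_mul,
    χ.sum_eq_zero_of_ne_one hχ, zero_mul, sub_zero]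

/-- divisor sums -/
noncomputable def lfR {d : ℕ} (χ : DirichletCharacter ℂ d) (n : ℕ) : ℂ :=
  ∑ p ∈ n.divisorsAntidiagonal, χ (p.1 : ZMod d)

lemma lf_hasSum_lambert {d : ℕ} [NeZero d] (χ : DirichletCharacter ℂ d) {x : ℝ} (hx : 0 < x) :
    Summable (fun n : ℕ+ => lfR χ n * (Real.exp (-n * x) : ℂ)) ∧
    HasSum (fun m : ℕ+ => χ ((m : ℕ) : ZMod d) * ((1 / (Real.exp (m * x) - 1) : ℝ) : ℂ))
      (∑' n : ℕ+, lfR χ n * (Real.exp (-n * x) : ℂ)) := by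
  have hr : ‖Real.exp (-x)‖ < 1 := by
    rw [Real.norm_eq_abs, Real.abs_exp]; simpa using hx
  have h0 : Summable (fun c : ℕ+ × ℕ+ => Real.exp (-((c.1 : ℕ) * (c.2 : ℕ)) * x)) := by
    have := summable_prod_mul_pow (𝕜 := ℝ) 0 hr
    refine this.congr fun c => ?_
    simp only [pow_zero, one_mul]
    rw [← Real.exp_nat_mul]
    congr 1; push_cast; ring
  have h1 : Summable (fun c : ℕ+ × ℕ+ => χ ((c.1 : ℕ) : ZMod d) *
      (Real.exp (-((c.1 : ℕ) * (c.2 : ℕ)) * x) : ℂ)) := by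
    refine Summable.of_norm_bounded h0 fun c => ?_
    rw [norm_mul, Complex.norm_real, Real.norm_of_nonneg (Real.exp_pos _).le]
    exact mul_le_of_le_one_left (Real.exp_pos _).le (χ.norm_le_one _)
  have h2 := (sigmaAntidiagonalEquivProd.hasSum_iff).2 h1.hasSum
  have h3 := h2.sigma (g := fun n : ℕ+ => lfR χ n * (Real.exp (-n * x) : ℂ)) (fun n => ?_)
  · refine ⟨h3.summable, ?_⟩
    rw [h3.tsum_eq]
    refine h1.hasSum.prod_fiberwise fun m => ?_
    have hm : 0 < (m : ℝ) := by exact_mod_cast m.pos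
    suffices hG : HasSum (fun k : ℕ+ => Real.exp (-((m : ℕ) * (k : ℕ)) * x))
        (1 / (Real.exp (m * x) - 1)) from
      HasSum.mul_left (χ ((m : ℕ) : ZMod d)) (Complex.hasSum_ofReal.2 hG)
    have hq : Real.exp (-(m * x)) < 1 := by
      rw [Real.exp_lt_one_iff]; nlinarith
    have g := (hasSum_geometric_of_lt_one (Real.exp_pos _).le hq).mul_left (Real.exp (-(m * x)))
    have g' := (Equiv.pnatEquivNat.hasSum_iff).2 g
    convert! g' using 1
    · ext k
      simp only [Function.comp_apply, Equiv.pnatEquivNat_apply]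
      rw [← pow_succ', PNat.natPred_add_one, ← Real.exp_nat_mul]
      congr 1; ring
    · rw [Real.exp_neg]
      have : 1 < Real.exp (m * x) := Real.one_lt_exp_iff.2 (by positivity)
      have h' : Real.exp (m * x) - 1 ≠ 0 := by linarith
      have : Real.exp (m*x) ≠ 0 := by positivity
      field_simp
  · have : ∀ c : Nat.divisorsAntidiagonal n, ((fun c : ℕ+ × ℕ+ => χ ((c.1 : ℕ) : ZMod d) *
      (Real.exp (-((c.1 : ℕ) * (c.2 : ℕ)) * x) : ℂ)) ∘ sigmaAntidiagonalEquivProd) ⟨n, c⟩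
      = χ ((c.1.1 : ℕ) : ZMod d) * (Real.exp (-n * x) : ℂ) := by
      rintro ⟨⟨k, l⟩, hkl⟩
      have := (Nat.mem_divisorsAntidiagonal.1 hkl).1
      simp only [Function.comp_apply, sigmaAntidiagonalEquivProd, divisorsAntidiagonalFactors,
        Equiv.coe_fn_mk, PNat.mk_coe]
      congr 4
      rw [← this]; push_cast; rfl
    simp only [this]
    rw [lfR, Finset.sum_mul, ← Finset.sum_coe_sort]
    exact hasSum_fintype _

lemma lf_lambert_lim {d : ℕ} [NeZero d] (χ : DirichletCharacter ℂ d) (hχ : χ ≠ 1) (hd : 1 < d) :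
    Filter.Tendsto (fun x : ℝ => 2 * (∑' n : ℕ+, lfR χ n * (Real.exp (-n * (2 * x)) : ℂ))
      - ∑' n : ℕ+, lfR χ n * (Real.exp (-n * x) : ℂ))
      (nhdsWithin 0 (Set.Ioi 0)) (nhds ((∑ j : ZMod d, χ j * ((j.val : ℂ) / d)) / 2)) := by
  have h := (lf_char_lim χ hχ).neg
  have e : -(∑ j : ZMod d, χ j * (-((j.val : ℂ) / d) / 2))
      = (∑ j : ZMod d, χ j * ((j.val : ℂ) / d)) / 2 := by
    rw [← Finset.sum_neg_distrib, Finset.sum_div]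
    refine Finset.sum_congr rfl fun j _ => ?_
    ring
  rw [e] at h
  refine h.congr' ?_
  filter_upwards [self_mem_nhdsWithin] with x hx
  have hx : 0 < x := hx
  have h1 := (lf_hasSum_lambert χ hx).2
  have h2 := (lf_hasSum_lambert χ (show 0 < 2 * x by positivity)).2
  have h3 := (h2.mul_left 2).sub h1
  rw [← h3.tsum_eq, ← tsum_neg]
  have h0 : χ ((0 : ℕ) : ZMod d) = 0 := by
    apply MulChar.map_nonunit
    have : Fact (1 < d) := ⟨hd⟩
    simp
  have h4 : (fun m : ℕ => -(χ (m : ZMod d) * (lfEta (m * x) : ℂ))) 0 = 0 := by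
    simp only [h0]; simp
  rw [← tsum_pnat_eq_tsum_of_eq_zero (f := fun m : ℕ => -(χ (m : ZMod d) * (lfEta (m * x) : ℂ))) h4]
  refine tsum_congr fun m => ?_
  have hm : 0 < (m : ℝ) := by exact_mod_cast m.pos
  have h5 : 1 < Real.exp (m * x) := Real.one_lt_exp_iff.2 (by positivity)
  have h6 : Real.exp (m * (2 * x)) = Real.exp (m * x) ^ 2 := by
    rw [← Real.exp_nat_mul]; congr 1; push_cast; ring
  have h7 : (2 * (1 / (Real.exp (m * (2 * x)) - 1)) - 1 / (Real.exp (m * x) - 1) : ℝ)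
      = - lfEta (m * x) := by
    rw [h6, lfEta]
    set q := Real.exp (m * x)
    have a1 : q - 1 ≠ 0 := by linarith
    have a2 : q + 1 ≠ 0 := by linarith
    have a3 : q ^ 2 - 1 ≠ 0 := by
      rw [show q ^ 2 - 1 = (q - 1) * (q + 1) by ring]; exact mul_ne_zero a1 a2
    rw [show q ^ 2 - 1 = (q - 1) * (q + 1) by ring]
    field_simp
    ring
  have h8 := congrArg (fun r : ℝ => (r : ℂ)) h7
  simp only [Complex.ofReal_sub, Complex.ofReal_mul, Complex.ofReal_neg, Complex.ofReal_ofNat] at h8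
  linear_combination (-χ ((m : ℕ) : ZMod d)) * h8

lemma lf_dvd_discr_iff (E : Type*) [Field E] [NumberField E] {p : ℕ} (hp : p.Prime) :
    (p : ℤ) ∣ discr E ↔ ∃ P : Ideal (𝓞 E), P.IsPrime ∧ Ideal.span {(p : 𝓞 E)} ≤ P ^ 2 := by
  have hpZ : Prime (p : ℤ) := Nat.prime_iff_prime_int.1 hp
  have key : ∀ (P : Ideal (𝓞 E)) (_ : P.IsPrime), (p : 𝓞 E) ∈ P →
      (Algebra.IsUnramifiedAt ℤ P ↔ ¬ Ideal.span {(p : 𝓞 E)} ≤ P ^ 2) := by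
    intro P hP hpP
    have hl : P.LiesOver (Ideal.span {(p : ℤ)}) :=
      (Ideal.liesOver_span_iff hP.ne_top hpZ).mpr (by simpa using hpP)
    have hmap : (Ideal.span {(p : ℤ)}).map (algebraMap ℤ (𝓞 E)) = Ideal.span {(p : 𝓞 E)} := by
      rw [Ideal.map_span]; simp
    have h0 : (Ideal.span {(p : ℤ)}) ≠ ⊥ := by
      rw [Ne, Ideal.span_singleton_eq_bot]; exact hpZ.ne_zero
    rw [← Ideal.ramificationIdx_eq_one_iff,
      ← Ideal.ramificationIdx'_eq_ramificationIdx (Ideal.span {(p : ℤ)}) P h0, ← hmap,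
      ← Ideal.ramificationIdx'_ne_one_iff, not_not]
    rw [hmap, Ideal.span_singleton_le_iff_mem]; exact hpP
  have h1 := (NumberField.not_dvd_discr_iff_forall_mem E (𝓞 E) hpZ).not
  rw [not_not] at h1
  rw [h1]
  constructor
  · intro h
    push Not at h
    obtain ⟨P, hP, hpP, hn⟩ := h
    refine ⟨P, hP, ?_⟩
    by_contra hc
    exact hn ((key P hP (by simpa using hpP)).2 hc)
  · rintro ⟨P, hP, hle⟩ hall
    have hpP : (p : 𝓞 E) ∈ P := Ideal.pow_le_self two_ne_zero (hle (Ideal.mem_span_singleton_self _))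
    exact (key P hP hpP).1 (hall P hP (by simpa using hpP)) hle

/-- number of ideals of norm `n` -/
noncomputable def lfCount (E : Type*) [Field E] [NumberField E] (n : ℕ) : ℕ :=
  Nat.card {I : Ideal (𝓞 E) // Ideal.absNorm I = n}

lemma lfCount_mul (E : Type*) [Field E] [NumberField E] {m n : ℕ} (hmn : m.Coprime n) (hm : m ≠ 0) : lfCount E (m * n) = lfCount E m * lfCount E n := by
  have hco : ∀ A B : Ideal (𝓞 E), (m : 𝓞 E) ∈ A → (n : 𝓞 E) ∈ B → A ⊔ B = ⊤ := by
    intro A B hA hB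
    have h : IsCoprime (m : ℤ) (n : ℤ) := Nat.isCoprime_iff_coprime.2 hmn
    obtain ⟨a, b, hab⟩ := h
    rw [Ideal.eq_top_iff_one]
    have h2 : (a : 𝓞 E) * m + b * n = 1 := by exact_mod_cast congrArg (fun z : ℤ => (z : 𝓞 E)) hab
    rw [← h2]
    exact Ideal.add_mem _ (Ideal.mul_mem_left _ _ (Ideal.mem_sup_left hA))
      (Ideal.mul_mem_left _ _ (Ideal.mem_sup_right hB))
  have hsup : ∀ A B : Ideal (𝓞 E), (m : 𝓞 E) ∈ A → (n : 𝓞 E) ∈ B →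
      A * B ⊔ Ideal.span {(m : 𝓞 E)} = A := by
    intro A B hA hB
    obtain ⟨A', hA'⟩ := Ideal.dvd_span_singleton.2 hA
    have : (m : 𝓞 E) ∈ A' := by
      have h1 : (m : 𝓞 E) ∈ A * A' := by
        rw [← hA']; exact Ideal.mem_span_singleton_self _
      exact Ideal.mul_le_right h1
    rw [hA', ← Ideal.mul_sup, sup_comm, hco A' B this hB, Ideal.mul_top]
  have hsup' : ∀ A B : Ideal (𝓞 E), (m : 𝓞 E) ∈ A → (n : 𝓞 E) ∈ B →
      A * B ⊔ Ideal.span {(n : 𝓞 E)} = B := by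
    intro A B hA hB
    obtain ⟨A', hA'⟩ := Ideal.dvd_span_singleton.2 hB
    have : (n : 𝓞 E) ∈ A' := by
      have h1 : (n : 𝓞 E) ∈ B * A' := by
        rw [← hA']; exact Ideal.mem_span_singleton_self _
      exact Ideal.mul_le_right h1
    rw [hA', mul_comm A B, ← Ideal.mul_sup, hco A A' hA this, Ideal.mul_top]
  have hmem : ∀ (k : ℕ) (A : Ideal (𝓞 E)), Ideal.absNorm A = k → (k : 𝓞 E) ∈ A := by
    rintro k A rfl; exact Ideal.absNorm_mem A
  unfold lfCount
  rw [← Nat.card_prod]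
  symm
  refine Nat.card_congr (Equiv.ofBijective (fun AB : {I : Ideal (𝓞 E) // Ideal.absNorm I = m} ×
    {I : Ideal (𝓞 E) // Ideal.absNorm I = n} => (⟨AB.1.1 * AB.2.1, by
      rw [map_mul, AB.1.2, AB.2.2]⟩ : {I : Ideal (𝓞 E) // Ideal.absNorm I = m * n})) ⟨?_, ?_⟩)
  · rintro ⟨⟨A, hA⟩, ⟨B, hB⟩⟩ ⟨⟨A', hA'⟩, ⟨B', hB'⟩⟩ h
    have h : A * B = A' * B' := congrArg Subtype.val h
    have e1 := hsup A B (hmem _ _ hA) (hmem _ _ hB)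
    have e2 := hsup A' B' (hmem _ _ hA') (hmem _ _ hB')
    have e3 := hsup' A B (hmem _ _ hA) (hmem _ _ hB)
    have e4 := hsup' A' B' (hmem _ _ hA') (hmem _ _ hB')
    rw [h] at e1 e3
    simp only [Prod.mk.injEq, Subtype.mk.injEq]
    exact ⟨e1.symm.trans e2, e3.symm.trans e4⟩
  · rintro ⟨I, hI⟩
    have hIm := hmem _ _ hI
    set A := I ⊔ Ideal.span {(m : 𝓞 E)} with hAdef
    set B := I ⊔ Ideal.span {(n : 𝓞 E)} with hBdef
    have hAm : (m : 𝓞 E) ∈ A := Ideal.mem_sup_right (Ideal.mem_span_singleton_self _)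
    have hBn : (n : 𝓞 E) ∈ B := Ideal.mem_sup_right (Ideal.mem_span_singleton_self _)
    have hAB : A * B = I := by
      apply le_antisymm
      · rw [hAdef, hBdef, Ideal.sup_mul, Ideal.mul_sup, Ideal.mul_sup]
        refine sup_le (sup_le Ideal.mul_le_left Ideal.mul_le_left) (sup_le Ideal.mul_le_right ?_)
        rw [Ideal.span_singleton_mul_span_singleton, Ideal.span_singleton_le_iff_mem]
        exact_mod_cast hIm
      · have : I = I * (A ⊔ B) := by rw [hco A B hAm hBn, Ideal.mul_top]
        rw [this, Ideal.mul_sup]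
        refine sup_le ?_ ?_
        · rw [mul_comm]; exact Ideal.mul_mono le_rfl le_sup_left
        · exact Ideal.mul_mono le_sup_left le_rfl
    have hcA : Nat.Coprime (Ideal.absNorm A) n := by
      have h1 : Ideal.absNorm A ∣ m ^ Module.finrank ℤ (𝓞 E) := by
        rw [← Ideal.absNorm_span_natCast]
        exact Ideal.absNorm_dvd_absNorm_of_le le_sup_right
      exact Nat.Coprime.coprime_dvd_left h1 (hmn.pow_left _)
    have hcB : Nat.Coprime (Ideal.absNorm B) m := by
      have h1 : Ideal.absNorm B ∣ n ^ Module.finrank ℤ (𝓞 E) := by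
        rw [← Ideal.absNorm_span_natCast]
        exact Ideal.absNorm_dvd_absNorm_of_le le_sup_right
      exact Nat.Coprime.coprime_dvd_left h1 (hmn.symm.pow_left _)
    have hprod : Ideal.absNorm A * Ideal.absNorm B = m * n := by rw [← map_mul, hAB, hI]
    have d1 : Ideal.absNorm A ∣ m := hcA.dvd_of_dvd_mul_right (Dvd.intro _ hprod)
    have d2 : m ∣ Ideal.absNorm A := hcB.symm.dvd_of_dvd_mul_right (Dvd.intro _ hprod.symm)
    have e1 := Nat.dvd_antisymm d1 d2
    have e2 : Ideal.absNorm B = n := by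
      rw [e1] at hprod; exact Nat.eq_of_mul_eq_mul_left (Nat.pos_of_ne_zero hm) hprod
    exact ⟨⟨⟨A, e1⟩, ⟨B, e2⟩⟩, Subtype.ext hAB⟩

lemma lfCount_inert (E : Type*) [Field E] [NumberField E] (hdeg : Module.finrank ℚ E = 2)
    {p : ℕ} (hp : p.Prime) (hP : (Ideal.span {(p : 𝓞 E)}).IsPrime) (k : ℕ) :
    lfCount E (p ^ k) = if Even k then 1 else 0 := by
  have hr : Module.finrank ℤ (𝓞 E) = 2 := by rw [RingOfIntegers.rank, hdeg]
  set P := Ideal.span {(p : 𝓞 E)} with hPdef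
  have hN : Ideal.absNorm P = p ^ 2 := by rw [hPdef, Ideal.absNorm_span_natCast, hr]
  have hP0 : P ≠ ⊥ := by
    intro h; rw [h, Ideal.absNorm_bot] at hN
    exact (pow_ne_zero 2 hp.ne_zero) hN.symm
  have hPp : Prime P := Ideal.prime_of_isPrime hP0 hP
  have hall : ∀ I : Ideal (𝓞 E), Ideal.absNorm I = p ^ k → ∃ i, I = P ^ i ∧ 2 * i = k := by
    intro I hI
    have h1 : I ∣ P ^ k := by
      rw [hPdef, Ideal.span_singleton_pow, Ideal.dvd_span_singleton]
      have := Ideal.absNorm_mem I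
      rw [hI] at this; exact_mod_cast this
    obtain ⟨i, -, hi⟩ := (dvd_prime_pow hPp k).1 h1
    rw [associated_iff_eq] at hi
    refine ⟨i, hi, ?_⟩
    rw [hi, map_pow, hN, ← pow_mul] at hI
    exact Nat.pow_right_injective hp.two_le hI
  unfold lfCount
  split_ifs with he
  · obtain ⟨j, hj⟩ := he
    rw [Nat.card_eq_one_iff_unique]
    refine ⟨⟨?_⟩, ⟨⟨P ^ j, ?_⟩⟩⟩
    · rintro ⟨I, hI⟩ ⟨J, hJ⟩
      obtain ⟨i, hi, hi2⟩ := hall I hI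
      obtain ⟨i', hi', hi2'⟩ := hall J hJ
      rw [Subtype.mk.injEq, hi, hi', show i = i' by omega]
    · rw [map_pow, hN, ← pow_mul, hj]; congr 1; omega
  · rw [Nat.card_eq_zero]
    left
    refine ⟨fun I => he ?_⟩
    obtain ⟨i, hi, hi2⟩ := hall I.1 I.2
    exact ⟨i, by omega⟩

lemma lfCount_ram (E : Type*) [Field E] [NumberField E]
    {p : ℕ} (hp : p.Prime) {P : Ideal (𝓞 E)} (hN : Ideal.absNorm P = p)
    (hPp : Prime P) (hsq : Ideal.span {(p : 𝓞 E)} = P ^ 2) (k : ℕ) :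
    lfCount E (p ^ k) = 1 := by
  have hall : ∀ I : Ideal (𝓞 E), Ideal.absNorm I = p ^ k → I = P ^ k := by
    intro I hI
    have h1 : I ∣ P ^ (2 * k) := by
      rw [pow_mul, ← hsq, Ideal.span_singleton_pow, Ideal.dvd_span_singleton]
      have := Ideal.absNorm_mem I
      rw [hI] at this; exact_mod_cast this
    obtain ⟨i, -, hi⟩ := (dvd_prime_pow hPp _).1 h1
    rw [associated_iff_eq] at hi
    rw [hi, map_pow, hN] at hI
    rw [hi, Nat.pow_right_injective hp.two_le hI]
  unfold lfCount
  rw [Nat.card_eq_one_iff_unique]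
  refine ⟨⟨?_⟩, ⟨⟨P ^ k, ?_⟩⟩⟩
  · rintro ⟨I, hI⟩ ⟨J, hJ⟩
    rw [Subtype.mk.injEq, hall I hI, hall J hJ]
  · rw [map_pow, hN]

lemma lfCount_split (E : Type*) [Field E] [NumberField E]
    {p : ℕ} (hp : p.Prime) {P Q : Ideal (𝓞 E)} (hNP : Ideal.absNorm P = p)
    (hNQ : Ideal.absNorm Q = p) (hPp : Prime P) (hQp : Prime Q) (hne : P ≠ Q)
    (hmul : Ideal.span {(p : 𝓞 E)} = P * Q) (k : ℕ) :
    lfCount E (p ^ k) = k + 1 := by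
  have hPQ : ∀ i, ¬ P ∣ Q ^ i := fun i h => by
    have := hPp.dvd_of_dvd_pow h
    exact hne (associated_iff_eq.1 ((hPp.dvd_prime_iff_associated hQp).1 this))
  unfold lfCount
  rw [← Nat.card_fin (k + 1)]
  symm
  refine Nat.card_congr (Equiv.ofBijective (fun i : Fin (k + 1) => (⟨P ^ (i : ℕ) * Q ^ (k - i), by
      rw [map_mul, map_pow, map_pow, hNP, hNQ, ← pow_add]; congr 1; omega⟩ :
        {I : Ideal (𝓞 E) // Ideal.absNorm I = p ^ k})) ⟨?_, ?_⟩)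
  · have key : ∀ i j : ℕ, i < j → ∀ a b, P ^ i * Q ^ a ≠ P ^ j * Q ^ b := by
      intro i j hij a b h
      obtain ⟨c, rfl⟩ := Nat.exists_eq_add_of_lt hij
      rw [show i + c + 1 = i + (c + 1) by ring, pow_add, mul_assoc] at h
      have h2 := mul_left_cancel₀ (pow_ne_zero i hPp.ne_zero) h
      apply hPQ a
      rw [h2, pow_succ', mul_assoc]
      exact Dvd.intro _ rfl
    intro i j h
    have h : P ^ (i : ℕ) * Q ^ (k - i) = P ^ (j : ℕ) * Q ^ (k - j) := congrArg Subtype.val h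
    rcases lt_trichotomy (i : ℕ) j with h1 | h1 | h1
    · exact absurd h (key _ _ h1 _ _)
    · exact Fin.ext h1
    · exact absurd h.symm (key _ _ h1 _ _)
  · rintro ⟨I, hI⟩
    have h1 : I ∣ P ^ k * Q ^ k := by
      rw [← mul_pow, ← hmul, Ideal.span_singleton_pow, Ideal.dvd_span_singleton]
      have := Ideal.absNorm_mem I
      rw [hI] at this; exact_mod_cast this
    obtain ⟨A, B, hA, hB, rfl⟩ := exists_dvd_and_dvd_of_dvd_mul h1
    obtain ⟨i, -, hi⟩ := (dvd_prime_pow hPp _).1 hA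
    obtain ⟨j, -, hj⟩ := (dvd_prime_pow hQp _).1 hB
    rw [associated_iff_eq] at hi hj
    rw [hi, hj, map_mul, map_pow, map_pow, hNP, hNQ, ← pow_add] at hI
    have := Nat.pow_right_injective hp.two_le hI
    refine ⟨⟨i, by omega⟩, Subtype.ext ?_⟩
    simp only [hi, hj]
    congr 2
    omega

lemma lf_prime_cases (E : Type*) [Field E] [NumberField E] (hdeg : Module.finrank ℚ E = 2)
    {p : ℕ} (hp : p.Prime) :
    ((Ideal.span {(p : 𝓞 E)}).IsPrime ∧ ¬ (p : ℤ) ∣ discr E) ∨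
    (¬ (Ideal.span {(p : 𝓞 E)}).IsPrime ∧ (p : ℤ) ∣ discr E ∧ ∀ k, lfCount E (p ^ k) = 1) ∨
    (¬ (Ideal.span {(p : 𝓞 E)}).IsPrime ∧ ¬ (p : ℤ) ∣ discr E ∧
      ∀ k, lfCount E (p ^ k) = k + 1) := by
  have hr : Module.finrank ℤ (𝓞 E) = 2 := by rw [RingOfIntegers.rank, hdeg]
  have hN : Ideal.absNorm (Ideal.span {(p : 𝓞 E)}) = p ^ 2 := by
    rw [Ideal.absNorm_span_natCast, hr]
  have hnorm : ∀ A B : Ideal (𝓞 E), Ideal.span {(p : 𝓞 E)} = A * B → A ≠ ⊤ → B ≠ ⊤ →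
      Ideal.absNorm A = p ∧ Ideal.absNorm B = p := by
    intro A B h hA hB
    rw [h, map_mul, pow_two] at hN
    have := (Nat.Prime.mul_eq_prime_sq_iff (x := Ideal.absNorm A) (y := Ideal.absNorm B)
      hp (fun h1 => hA (Ideal.absNorm_eq_one_iff.1 h1))
      (fun h1 => hB (Ideal.absNorm_eq_one_iff.1 h1))).1 (by rw [hN, pow_two])
    exact this
  have hprime : ∀ A : Ideal (𝓞 E), Ideal.absNorm A = p → Prime A := by
    intro A hA
    have h1 : Irreducible (Ideal.absNorm A) := by rw [hA]; exact hp
    have h2 := Ideal.isPrime_of_irreducible_absNorm h1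
    refine Ideal.prime_of_isPrime ?_ h2
    rintro rfl
    rw [Ideal.absNorm_bot] at hA
    exact hp.ne_zero hA.symm
  by_cases hP : (Ideal.span {(p : 𝓞 E)}).IsPrime
  · left
    refine ⟨hP, fun hd => ?_⟩
    obtain ⟨Q, hQ, hle⟩ := (lf_dvd_discr_iff E hp).1 hd
    obtain ⟨C, hC⟩ := Ideal.dvd_iff_le.2 hle
    have h1 := congrArg Ideal.absNorm hC
    rw [hN, map_mul, map_pow] at h1
    have h2 : Ideal.absNorm Q ∣ p := by
      rw [← Nat.pow_dvd_pow_iff two_ne_zero]; exact Dvd.intro _ h1.symm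
    rcases (Nat.dvd_prime hp).1 h2 with h3 | h3
    · exact hQ.ne_top (Ideal.absNorm_eq_one_iff.1 h3)
    · have hle2 : Q * Q ≤ Ideal.span {(p : 𝓞 E)} := by
        have : Ideal.absNorm C = 1 := by
          rw [h3] at h1
          have h0 : 0 < p ^ 2 := pow_pos hp.pos 2
          nlinarith
        rw [Ideal.absNorm_eq_one_iff] at this
        rw [hC, this, Ideal.mul_top, pow_two]
      have h4 : Q ≤ Ideal.span {(p : 𝓞 E)} := by
        rcases (hP.mul_le).1 hle2 with h | h <;> exact h
      have h5 := Ideal.absNorm_dvd_absNorm_of_le h4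
      rw [hN, h3] at h5
      have := Nat.le_of_dvd hp.pos h5
      have := hp.two_le
      nlinarith
  · right
    have htop : Ideal.span {(p : 𝓞 E)} ≠ ⊤ := by
      intro h; rw [h, Ideal.absNorm_top] at hN
      have := hp.two_le
      nlinarith
    obtain ⟨P, hPm, hle⟩ := Ideal.exists_le_maximal _ htop
    obtain ⟨Q, hQ⟩ := Ideal.dvd_iff_le.2 hle
    have hQt : Q ≠ ⊤ := by
      rintro rfl
      rw [Ideal.mul_top] at hQ
      exact hP (hQ ▸ hPm.isPrime)
    obtain ⟨n1, n2⟩ := hnorm P Q hQ hPm.ne_top hQt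
    by_cases hPQ : P = Q
    · left
      subst hPQ
      rw [← pow_two] at hQ
      exact ⟨hP, (lf_dvd_discr_iff E hp).2 ⟨P, hPm.isPrime, hQ.le⟩,
        lfCount_ram E hp n1 (hprime P n1) hQ⟩
    · right
      refine ⟨hP, fun hd => hPQ ?_, lfCount_split E hp n1 n2 (hprime P n1) (hprime Q n2) hPQ hQ⟩
      obtain ⟨A, hA, hle⟩ := (lf_dvd_discr_iff E hp).1 hd
      have hd1 : A ^ 2 ∣ P * Q := hQ ▸ Ideal.dvd_iff_le.2 hle
      have hA0 : A ≠ ⊥ := by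
        rintro rfl
        rw [pow_two, Ideal.bot_mul, ← Ideal.zero_eq_bot, zero_dvd_iff, mul_eq_zero] at hd1
        rcases hd1 with h | h
        · exact (hprime P n1).ne_zero h
        · exact (hprime Q n2).ne_zero h
      have hAp := Ideal.prime_of_isPrime hA0 hA
      have aux : ∀ P Q : Ideal (𝓞 E), Prime P → Prime Q → A ^ 2 ∣ P * Q → A ∣ P → P = Q := by
        intro P Q hP hQ h1 h2
        have e1 : A = P := associated_iff_eq.1 ((hAp.dvd_prime_iff_associated hP).1 h2)
        subst e1
        rw [pow_two, mul_dvd_mul_iff_left hAp.ne_zero] at h1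
        exact associated_iff_eq.1 ((hAp.dvd_prime_iff_associated hQ).1 h1)
      rcases hAp.dvd_or_dvd ((dvd_pow_self A two_ne_zero).trans hd1) with h | h
      · exact aux P Q (hprime P n1) (hprime Q n2) hd1 h
      · exact (aux Q P (hprime Q n2) (hprime P n1) (mul_comm P Q ▸ hd1) h).symm

lemma lfCount_eq (E : Type*) [Field E] [NumberField E] {d : ℕ} [NeZero d]
    (hdeg : Module.finrank ℚ E = 2) (hdisc : NumberField.discr E = -(d : ℤ))
    (χ : DirichletCharacter ℂ d)
    (hχquad : ∀ u : (ZMod d)ˣ, χ u = 1 ∨ χ u = -1)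
    (hχ : ∀ p : ℕ, p.Prime → ¬ p ∣ d →
      (χ (p : ZMod d) = -1 ↔ (Ideal.span {(p : 𝓞 E)} : Ideal (𝓞 E)).IsPrime))
    {n : ℕ} (hn : n ≠ 0) : (lfCount E n : ℂ) = lfR χ n := by
  let g : ArithmeticFunction ℂ := ⟨fun n => if n = 0 then 0 else χ (n : ZMod d), by simp⟩
  let c : ArithmeticFunction ℂ := ⟨fun n => if n = 0 then 0 else (lfCount E n : ℂ), by simp⟩
  have hg : g.IsMultiplicative := by
    rw [ArithmeticFunction.IsMultiplicative.iff_ne_zero]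
    refine ⟨by simp [g], fun {m n} hm hn _ => ?_⟩
    simp [g, hm, hn]
  have h1 : lfCount E 1 = 1 := by
    unfold lfCount
    rw [Nat.card_eq_one_iff_unique]
    refine ⟨⟨?_⟩, ⟨⟨⊤, by simp⟩⟩⟩
    rintro ⟨I, hI⟩ ⟨J, hJ⟩
    rw [Subtype.mk.injEq, Ideal.absNorm_eq_one_iff.1 hI, Ideal.absNorm_eq_one_iff.1 hJ]
  have hc : c.IsMultiplicative := by
    rw [ArithmeticFunction.IsMultiplicative.iff_ne_zero]
    refine ⟨by simp [c, h1], fun {m n} hm hn hmn => ?_⟩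
    simp [c, hm, hn, lfCount_mul E hmn hm]
  have hR : ∀ n, (g * (ArithmeticFunction.zeta : ArithmeticFunction ℂ)) n = lfR χ n := by
    intro n
    rw [ArithmeticFunction.mul_apply, lfR]
    refine Finset.sum_congr rfl fun x hx => ?_
    have := Nat.ne_zero_of_mem_divisorsAntidiagonal hx
    simp [g, this.1, this.2]
  have key : c = g * (ArithmeticFunction.zeta : ArithmeticFunction ℂ) := by
    rw [ArithmeticFunction.IsMultiplicative.eq_iff_eq_on_prime_powers c hc _
      (hg.mul ArithmeticFunction.isMultiplicative_zeta.natCast)]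
    intro p k hp
    have e1 : c (p ^ k) = lfCount E (p ^ k) := by simp [c, hp.ne_zero]
    have e2 : lfR χ (p ^ k) = ∑ i ∈ Finset.range (k + 1), χ (p : ZMod d) ^ i := by
      rw [lfR, Nat.sum_divisorsAntidiagonal (fun i _ => χ (i : ZMod d)), Nat.sum_divisors_prime_pow hp]
      refine Finset.sum_congr rfl fun i _ => ?_
      rw [Nat.cast_pow, map_pow]
    rw [hR, e1, e2]
    have hpd : (p : ℤ) ∣ discr E ↔ p ∣ d := by rw [hdisc, dvd_neg, Int.natCast_dvd_natCast]
    have hcop : ¬ p ∣ d → (χ (p : ZMod d) = 1 ∨ χ (p : ZMod d) = -1) := by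
      intro h
      have := hχquad (ZMod.unitOfCoprime p ((Nat.Prime.coprime_iff_not_dvd hp).2 h))
      simpa using this
    rcases lf_prime_cases E hdeg hp with ⟨h2, h3⟩ | ⟨h2, h3, h4⟩ | ⟨h2, h3, h4⟩
    · rw [hpd] at h3
      rw [(hχ p hp h3).2 h2, lfCount_inert E hdeg hp h2, neg_one_geom_sum]
      rcases Nat.even_or_odd k with h | h
      · simp [h, Nat.even_add_one]
      · simp [Nat.even_add_one, Nat.not_even_iff_odd.2 h]
    · rw [hpd] at h3
      have : χ (p : ZMod d) = 0 := by
        apply MulChar.map_nonunit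
        rw [ZMod.isUnit_iff_coprime, Nat.Prime.coprime_iff_not_dvd hp, not_not]
        exact h3
      rw [this, h4]
      simp [zero_geom_sum]
    · rw [hpd] at h3
      rcases hcop h3 with h5 | h5
      · rw [h5, h4]; simp
      · exact absurd ((hχ p hp h3).1 h5) h2
  have := congrArg (fun f => f n) key
  simp only [hR] at this
  rw [← this]
  simp [c, hn]

lemma lf_card_places (E : Type*) [Field E] [NumberField E] (hdeg : Module.finrank ℚ E = 2)
    (hneg : discr E < 0) : Fintype.card (InfinitePlace E) = 1 ∧ IsTotallyComplex E := by
  have h1 := sign_discr E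
  rw [Int.sign_eq_neg_one_of_neg hneg] at h1
  have h2 := InfinitePlace.card_add_two_mul_card_eq_rank E
  rw [hdeg] at h2
  have h3 : InfinitePlace.nrComplexPlaces E ≠ 0 := by
    intro h; rw [h] at h1; norm_num at h1
  have h4 : InfinitePlace.nrComplexPlaces E = 1 := by omega
  have h5 : InfinitePlace.nrRealPlaces E = 0 := by omega
  refine ⟨?_, nrRealPlaces_eq_zero_iff.1 h5⟩
  rw [InfinitePlace.card_eq_nrRealPlaces_add_nrComplexPlaces, h4, h5]

lemma lf_norm (E : Type*) [Field E] [NumberField E] (hdeg : Module.finrank ℚ E = 2)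
    (hneg : discr E < 0) : ∃ σ : E →+* ℂ, ∀ x : 𝓞 E,
      (Ideal.absNorm (Ideal.span {x}) : ℝ) = ‖σ (x : E)‖ ^ 2 := by
  obtain ⟨h1, h2⟩ := lf_card_places E hdeg hneg
  obtain ⟨v, hv⟩ := Fintype.card_eq_one_iff.1 h1
  refine ⟨v.embedding, fun x => ?_⟩
  have h3 := InfinitePlace.prod_eq_abs_norm (x : E)
  rw [Fintype.prod_eq_single v (fun w hw => absurd (hv w) hw), IsTotallyComplex.mult_eq] at h3
  rw [InfinitePlace.norm_embedding_eq, h3, Ideal.absNorm_span_singleton,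
    ← Algebra.coe_norm_int]
  simp

lemma lf_units (E : Type*) [Field E] [NumberField E] (hdeg : Module.finrank ℚ E = 2)
    (hneg : discr E < 0) : Finite (𝓞 E)ˣ ∧ Nat.card (𝓞 E)ˣ = Nat.card (Units.torsion E) := by
  obtain ⟨h1, h2⟩ := lf_card_places E hdeg hneg
  have hr : Units.rank E = 0 := by rw [Units.rank, h1]
  have htop : Units.torsion E = ⊤ := by
    rw [eq_top_iff]
    intro x _
    obtain ⟨⟨ζ, e⟩, h, -⟩ := Units.exist_unique_eq_mul_prod E x
    have : IsEmpty (Fin (Units.rank E)) := by rw [hr]; infer_instance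
    rw [Finset.univ_eq_empty, Finset.prod_empty, mul_one] at h
    rw [h]; exact ζ.2
  have hc : Nat.card (Units.torsion E) = Nat.card (𝓞 E)ˣ := by rw [htop, Subgroup.card_top]
  refine ⟨?_, hc.symm⟩
  have : Finite (⊤ : Subgroup (𝓞 E)ˣ) := by rw [← htop]; infer_instance
  exact Finite.of_equiv _ Subgroup.topEquiv.toEquiv

lemma lf_quad (E : Type*) [Field E] [NumberField E] (hdeg : Module.finrank ℚ E = 2)
    (hneg : discr E < 0) (J : Ideal (𝓞 E)) (hJ : J ≠ ⊥) :
    ∃ (A B C : ℝ) (e : ℤ × ℤ ≃ J), e 0 = 0 ∧ 0 < A ∧ B ^ 2 < 4 * A * C ∧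
      ∀ p : ℤ × ℤ, (Ideal.absNorm (Ideal.span {(e p : 𝓞 E)}) : ℝ)
        = A * p.2 ^ 2 + B * p.2 * p.1 + C * p.1 ^ 2 := by
  obtain ⟨σ, hσ⟩ := lf_norm E hdeg hneg
  have hr : Module.finrank ℤ (𝓞 E) = 2 := by rw [RingOfIntegers.rank, hdeg]
  let b0 : Module.Basis (Fin 2) ℤ (𝓞 E) := (Module.finBasis ℤ (𝓞 E)).reindex (finCongr hr)
  let b : Module.Basis (Fin 2) ℤ J := J.selfBasis b0 hJ
  let e : ℤ × ℤ ≃ J := (finTwoArrowEquiv ℤ).symm.trans b.equivFun.symm.toEquiv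
  have he : ∀ p : ℤ × ℤ, (e p : 𝓞 E) = p.1 * (b 0 : 𝓞 E) + p.2 * (b 1 : 𝓞 E) := by
    intro p
    simp [e, Module.Basis.equivFun_symm_apply, finTwoArrowEquiv]
  have he0 : e 0 = 0 := by
    apply Subtype.ext
    rw [he]; simp
  set β := (b 0 : 𝓞 E)
  set α := (b 1 : 𝓞 E)
  have hpos : ∀ p : ℤ × ℤ, p ≠ 0 → 0 < ‖σ ((e p : 𝓞 E) : E)‖ ^ 2 := by
    intro p hp
    have : (e p : 𝓞 E) ≠ 0 := by
      intro h
      apply hp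
      apply e.injective
      rw [he0]; exact Subtype.ext h
    have h2 : ((e p : 𝓞 E) : E) ≠ 0 := by simpa using this
    have h3 : σ ((e p : 𝓞 E) : E) ≠ 0 := by rwa [Ne, map_eq_zero]
    positivity
  set s := σ (α : E) with hs
  set t := σ (β : E) with ht
  have hexp : ∀ p : ℤ × ℤ, ‖σ ((e p : 𝓞 E) : E)‖ ^ 2 = ‖s‖ ^ 2 * p.2 ^ 2 +
      2 * (s.re * t.re + s.im * t.im) * p.2 * p.1 + ‖t‖ ^ 2 * p.1 ^ 2 := by
    intro p
    have : σ ((e p : 𝓞 E) : E) = p.1 * t + p.2 * s := by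
      rw [he, hs, ht]; simp
    rw [this, ← Complex.normSq_eq_norm_sq, ← Complex.normSq_eq_norm_sq, ← Complex.normSq_eq_norm_sq]
    simp only [Complex.normSq_apply, Complex.add_re, Complex.mul_re, Complex.add_im, Complex.mul_im,
      Complex.intCast_re, Complex.intCast_im]
    ring
  -- integrality
  have hA : 0 < ‖s‖ ^ 2 := by
    have h := hpos (0, 1) (by simp)
    rw [hexp] at h; simpa using h
  obtain ⟨A', hA'⟩ : ∃ z : ℤ, (z : ℝ) = ‖s‖ ^ 2 := ⟨_, by rw [hs, ← hσ]; norm_cast⟩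
  obtain ⟨B', hB'⟩ : ∃ z : ℤ, (z : ℝ) = 2 * (s.re * t.re + s.im * t.im) := by
    have h1 := hexp (1, 1)
    rw [← hσ] at h1
    have h2 := hσ α
    have h3 := hσ β
    rw [← hs] at h2
    rw [← ht] at h3
    rw [← h2, ← h3] at h1
    refine ⟨(Ideal.absNorm (Ideal.span {(e (1, 1) : 𝓞 E)}) : ℤ) -
      Ideal.absNorm (Ideal.span {α}) - Ideal.absNorm (Ideal.span {β}), ?_⟩
    push_cast at h1 ⊢
    linarith
  refine ⟨‖s‖ ^ 2, 2 * (s.re * t.re + s.im * t.im), ‖t‖ ^ 2, e, he0, hA, ?_, fun p => by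
    rw [hσ, hexp]⟩
  have h := hpos (2 * A', -B') (by
    intro h
    have h1 : 2 * A' = 0 := congrArg Prod.fst h
    have : (A' : ℝ) = 0 := by exact_mod_cast (by omega : A' = 0)
    rw [← hA', this] at hA
    exact lt_irrefl _ hA)
  rw [hexp] at h
  push_cast at h
  rw [← hA', ← hB'] at h ⊢
  rw [← hA'] at hA
  have h4 : 0 < (A' : ℝ) * (4 * A' * ‖t‖ ^ 2 - (B' : ℝ) ^ 2) := by nlinarith
  have := (mul_pos_iff_of_pos_left hA).1 h4
  linarith

lemma lf_class_bij (E : Type*) [Field E] [NumberField E] (J : nonZeroDivisors (Ideal (𝓞 E))) :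
    ∃ φ : {I : nonZeroDivisors (Ideal (𝓞 E)) // ClassGroup.mk0 I = (ClassGroup.mk0 J)⁻¹} × (𝓞 E)ˣ ≃
      (({0} : Set (J : Ideal (𝓞 E)))ᶜ : Set (J : Ideal (𝓞 E))),
      ∀ q, Ideal.absNorm (Ideal.span {((φ q : (J : Ideal (𝓞 E))) : 𝓞 E)}) =
        Ideal.absNorm (q.1.1 : Ideal (𝓞 E)) * Ideal.absNorm (J : Ideal (𝓞 E)) := by
  have hJ0 : (J : Ideal (𝓞 E)) ≠ 0 := nonZeroDivisors.coe_ne_zero J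
  have hgen : ∀ I : {I : nonZeroDivisors (Ideal (𝓞 E)) //
      ClassGroup.mk0 I = (ClassGroup.mk0 J)⁻¹}, ∃ g : 𝓞 E,
      (I.1 : Ideal (𝓞 E)) * (J : Ideal (𝓞 E)) = Ideal.span {g} := by
    intro I
    have h1 : ClassGroup.mk0 (I.1 * J) = 1 := by rw [map_mul, I.2, inv_mul_cancel]
    have h2 := (ClassGroup.mk0_eq_one_iff (I := ((I.1 * J : nonZeroDivisors (Ideal (𝓞 E))) : Ideal (𝓞 E))) (I.1 * J).2).1 h1
    obtain ⟨g, hg⟩ := h2.principal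
    exact ⟨g, hg⟩
  choose g hg using hgen
  have hg0 : ∀ I, g I ≠ 0 := by
    intro I h
    have := hg I
    rw [h, Ideal.span_singleton_zero] at this
    exact mul_ne_zero (nonZeroDivisors.coe_ne_zero I.1) hJ0 this
  have hmem : ∀ I, g I ∈ (J : Ideal (𝓞 E)) := by
    intro I
    have : g I ∈ (I.1 : Ideal (𝓞 E)) * (J : Ideal (𝓞 E)) := by
      rw [hg]; exact Ideal.mem_span_singleton_self _
    exact Ideal.mul_le_right this
  have hspan : ∀ I (u : (𝓞 E)ˣ), Ideal.span {(u : 𝓞 E) * g I} = Ideal.span {g I} := by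
    intro I u
    exact Ideal.span_singleton_mul_left_unit u.isUnit _
  let f : {I : nonZeroDivisors (Ideal (𝓞 E)) // ClassGroup.mk0 I = (ClassGroup.mk0 J)⁻¹} × (𝓞 E)ˣ →
      (({0} : Set (J : Ideal (𝓞 E)))ᶜ : Set (J : Ideal (𝓞 E))) := fun q =>
    ⟨⟨(q.2 : 𝓞 E) * g q.1, Ideal.mul_mem_left _ _ (hmem _)⟩, by
      intro h
      have h' : (q.2 : 𝓞 E) * g q.1 = 0 := congrArg Subtype.val h
      exact mul_ne_zero q.2.ne_zero (hg0 _) h'⟩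
  have hf : Function.Bijective f := by
    constructor
    · rintro ⟨I, u⟩ ⟨I', u'⟩ h
      have h' : (u : 𝓞 E) * g I = (u' : 𝓞 E) * g I' :=
        congrArg (fun z => ((z.1 : (J : Ideal (𝓞 E))) : 𝓞 E)) h
      have hII : I = I' := by
        have h2 : (I.1 : Ideal (𝓞 E)) * (J : Ideal (𝓞 E)) = I'.1 * (J : Ideal (𝓞 E)) := by
          rw [hg, hg, ← hspan I u, ← hspan I' u', h']
        exact Subtype.ext (Subtype.ext (mul_right_cancel₀ hJ0 h2))
      subst hII
      have h3 := mul_right_cancel₀ (hg0 I) h'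
      rw [Prod.mk.injEq]
      exact ⟨rfl, Units.ext h3⟩
    · rintro ⟨⟨x, hxJ⟩, hx⟩
      have hx0 : x ≠ 0 := fun h => hx (Subtype.ext h)
      obtain ⟨I, hI⟩ := Ideal.dvd_span_singleton.2 hxJ
      have hI0 : I ≠ 0 := by
        rintro rfl
        rw [mul_zero, Ideal.zero_eq_bot, Ideal.span_singleton_eq_bot] at hI
        exact hx0 hI
      let I' : nonZeroDivisors (Ideal (𝓞 E)) := ⟨I, mem_nonZeroDivisors_of_ne_zero hI0⟩
      have hcl : ClassGroup.mk0 I' = (ClassGroup.mk0 J)⁻¹ := by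
        rw [eq_inv_iff_mul_eq_one, ← map_mul]
        refine (ClassGroup.mk0_eq_one_iff (I := ((I' * J : nonZeroDivisors (Ideal (𝓞 E))) : Ideal (𝓞 E))) (I' * J).2).2 ?_
        refine ⟨⟨x, ?_⟩⟩
        rw [← Ideal.submodule_span_eq] at hI
        rw [hI, mul_comm]; rfl
      have h4 : Ideal.span {x} = Ideal.span {g ⟨I', hcl⟩} := by
        rw [← hg, hI, mul_comm]
      rw [Ideal.span_singleton_eq_span_singleton] at h4
      obtain ⟨u, hu⟩ := h4.symm
      refine ⟨⟨⟨I', hcl⟩, u⟩, ?_⟩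
      apply Subtype.ext
      apply Subtype.ext
      change (u : 𝓞 E) * g ⟨I', hcl⟩ = x
      rw [mul_comm]; exact hu
  refine ⟨Equiv.ofBijective f hf, fun q => ?_⟩
  rw [← map_mul, hg, ← hspan q.1 q.2]
  rfl

lemma lf_class_lim (E : Type*) [Field E] [NumberField E] (hdeg : Module.finrank ℚ E = 2)
    (hneg : discr E < 0) (c : ClassGroup (𝓞 E)) :
    (∀ x : ℝ, 0 < x → Summable (fun I : {I : nonZeroDivisors (Ideal (𝓞 E)) // ClassGroup.mk0 I = c} =>
      Real.exp (-x * Ideal.absNorm (I.1 : Ideal (𝓞 E))))) ∧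
    ∃ K : ℝ, Filter.Tendsto (fun x : ℝ => (Nat.card (Units.torsion E) : ℝ) *
      (∑' I : {I : nonZeroDivisors (Ideal (𝓞 E)) // ClassGroup.mk0 I = c},
      Real.exp (-x * Ideal.absNorm (I.1 : Ideal (𝓞 E)))) + 1 - K / x)
      (nhdsWithin 0 (Set.Ioi 0)) (nhds 0) := by
  obtain ⟨J, hJ⟩ := ClassGroup.mk0_surjective c⁻¹
  obtain rfl : c = (ClassGroup.mk0 J)⁻¹ := by rw [hJ, inv_inv]
  obtain ⟨hfin, hcard⟩ := lf_units E hdeg hneg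
  have hJ0 : (J : Ideal (𝓞 E)) ≠ ⊥ := nonZeroDivisors.coe_ne_zero J
  obtain ⟨A, B, C, e, he0, hA, hD, hQ⟩ := lf_quad E hdeg hneg J hJ0
  obtain ⟨φ, hφ⟩ := lf_class_bij E J
  set N : ℝ := ((Ideal.absNorm (J : Ideal (𝓞 E)) : ℕ) : ℝ) with hN
  have hNpos : 0 < N := by
    rw [hN]; exact_mod_cast Ideal.absNorm_pos_of_nonZeroDivisors J
  obtain ⟨hS, K, hK⟩ := lf_theta_form (A := A / N) (B := B / N) (C := C / N) (by positivity) (by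
    rw [div_pow, show 4 * (A / N) * (C / N) = (4 * A * C) / N ^ 2 by ring]
    exact div_lt_div_of_pos_right hD (by positivity))
  have hcongr : ∀ (x : ℝ) (p : ℤ × ℤ),
      Real.exp (-x * (A / N * p.2 ^ 2 + B / N * p.2 * p.1 + C / N * p.1 ^ 2)) =
      Real.exp (-x * (Ideal.absNorm (Ideal.span {(e p : 𝓞 E)}) / N)) := by
    intro x p; rw [hQ]; congr 1; ring
  simp only [hcongr] at hS hK
  set F : ℝ → ↥(J : Ideal (𝓞 E)) → ℝ := fun x l =>
    Real.exp (-x * (Ideal.absNorm (Ideal.span {(l : 𝓞 E)}) / N)) with hF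
  have hS1 : ∀ x, 0 < x → Summable (F x) := fun x hx => (e.summable_iff (f := F x)).1 (hS x hx)
  have hT1 : ∀ x, ∑' p : ℤ × ℤ, Real.exp (-x * (Ideal.absNorm (Ideal.span {(e p : 𝓞 E)}) / N))
      = ∑' l, F x l := fun x => e.tsum_eq (F x)
  have hφF : ∀ x q, F x (φ q) = Real.exp (-x * Ideal.absNorm (q.1.1 : Ideal (𝓞 E))) := by
    intro x q
    simp only [hF]
    rw [hφ, Nat.cast_mul, ← hN, mul_div_cancel_right₀ _ hNpos.ne']
  have hS2 : ∀ x, 0 < x → Summable (fun q : {I : nonZeroDivisors (Ideal (𝓞 E)) //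
      ClassGroup.mk0 I = (ClassGroup.mk0 J)⁻¹} × (𝓞 E)ˣ =>
      Real.exp (-x * Ideal.absNorm (q.1.1 : Ideal (𝓞 E)))) := by
    intro x hx
    have h1 := (hS1 x hx).subtype (({0} : Set (J : Ideal (𝓞 E)))ᶜ)
    have h2 := (φ.summable_iff).2 h1
    refine h2.congr fun q => ?_
    exact hφF x q
  have hS3 : ∀ x, 0 < x → Summable (fun I : {I : nonZeroDivisors (Ideal (𝓞 E)) //
      ClassGroup.mk0 I = (ClassGroup.mk0 J)⁻¹} =>
      Real.exp (-x * Ideal.absNorm (I.1 : Ideal (𝓞 E)))) := by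
    intro x hx
    exact (hS2 x hx).comp_injective (i := fun I => (I, (1 : (𝓞 E)ˣ)))
      (fun a b h => congrArg Prod.fst h)
  refine ⟨hS3, K, hK.congr' ?_⟩
  filter_upwards [self_mem_nhdsWithin] with x hx
  have hx : 0 < x := hx
  congr 1
  rw [hT1, ← (hS1 x hx).tsum_subtype_add_tsum_subtype_compl {0}]
  have h0 : ∑' l : ({0} : Set (J : Ideal (𝓞 E))), F x l = 1 := by
    rw [tsum_singleton (0 : (J : Ideal (𝓞 E))) (F x)]
    simp [hF]
  have h1 : ∑' l : (({0} : Set (J : Ideal (𝓞 E)))ᶜ : Set (J : Ideal (𝓞 E))), F x l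
      = (Nat.card (Units.torsion E) : ℝ) *
      (∑' I : {I : nonZeroDivisors (Ideal (𝓞 E)) // ClassGroup.mk0 I = (ClassGroup.mk0 J)⁻¹},
      Real.exp (-x * Ideal.absNorm (I.1 : Ideal (𝓞 E)))) := by
    rw [← φ.tsum_eq]
    simp only [hφF]
    have := Fintype.ofFinite (𝓞 E)ˣ
    rw [(hS2 x hx).tsum_prod, ← hcard, ← tsum_mul_left]
    refine tsum_congr fun I => ?_
    rw [tsum_fintype]
    simp only
    rw [Finset.sum_const, Finset.card_univ, nsmul_eq_mul, Nat.card_eq_fintype_card]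
  rw [h0, h1, add_comm]

lemma lf_count_lim (E : Type*) [Field E] [NumberField E] (hdeg : Module.finrank ℚ E = 2)
    (hneg : discr E < 0) :
    Filter.Tendsto (fun x : ℝ => (Nat.card (Units.torsion E) : ℝ) *
      (2 * (∑' n : ℕ+, (lfCount E n : ℝ) * Real.exp (-n * (2 * x)))
        - ∑' n : ℕ+, (lfCount E n : ℝ) * Real.exp (-n * x)))
      (nhdsWithin 0 (Set.Ioi 0)) (nhds (-(classNumber E : ℝ))) := by
  choose hS K hK using lf_class_lim E hdeg hneg
  set w : ℝ := (Nat.card (Units.torsion E) : ℝ)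
  have hdec : ∀ x : ℝ, 0 < x → ∑' n : ℕ+, (lfCount E n : ℝ) * Real.exp (-n * x) =
      ∑ c : ClassGroup (𝓞 E), ∑' I : {I : nonZeroDivisors (Ideal (𝓞 E)) // ClassGroup.mk0 I = c},
      Real.exp (-x * Ideal.absNorm (I.1 : Ideal (𝓞 E))) := by
    intro x hx
    let f : nonZeroDivisors (Ideal (𝓞 E)) → ℝ := fun I =>
      Real.exp (-x * Ideal.absNorm (I : Ideal (𝓞 E)))
    have s1 : Summable (f ∘ Equiv.sigmaFiberEquiv (ClassGroup.mk0 (R := 𝓞 E))) := by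
      exact (summable_sigma_of_nonneg
        (f := f ∘ Equiv.sigmaFiberEquiv (ClassGroup.mk0 (R := 𝓞 E)))
        (fun _ => (Real.exp_pos _).le)).2 ⟨fun c => hS c x hx, Summable.of_finite⟩
    have s2 : Summable f := (Equiv.summable_iff _).1 s1
    have t1 : ∑' I, f I = ∑ c : ClassGroup (𝓞 E),
        ∑' I : {I : nonZeroDivisors (Ideal (𝓞 E)) // ClassGroup.mk0 I = c},
        Real.exp (-x * Ideal.absNorm (I.1 : Ideal (𝓞 E))) := by
      refine ((Equiv.sigmaFiberEquiv (ClassGroup.mk0 (R := 𝓞 E))).tsum_eq f).symm.trans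
        (s1.tsum_sigma.trans ?_)
      rw [tsum_fintype]
      rfl
    rw [← t1]
    let ν : nonZeroDivisors (Ideal (𝓞 E)) → ℕ+ := fun I =>
      ⟨Ideal.absNorm (I : Ideal (𝓞 E)), Ideal.absNorm_pos_of_nonZeroDivisors I⟩
    have s3 : Summable (f ∘ Equiv.sigmaFiberEquiv ν) := (Equiv.summable_iff _).2 s2
    refine Eq.symm (((Equiv.sigmaFiberEquiv ν).tsum_eq f).symm.trans (s3.tsum_sigma.trans ?_))
    symm
    refine tsum_congr fun n => ?_
    have hval : ∀ I : {I // ν I = n}, f (Equiv.sigmaFiberEquiv ν ⟨n, I⟩) = Real.exp (-n * x) := by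
      intro I
      have h1 : Ideal.absNorm (I.1 : Ideal (𝓞 E)) = (n : ℕ) := congrArg PNat.val I.2
      change Real.exp (-x * Ideal.absNorm (I.1 : Ideal (𝓞 E))) = _
      rw [h1]; congr 1; ring
    simp only [Function.comp_apply, hval]
    let ψ : {I // ν I = n} ≃ {I : Ideal (𝓞 E) // Ideal.absNorm I = n} :=
      { toFun := fun I => ⟨I.1.1, congrArg PNat.val I.2⟩
        invFun := fun I => ⟨⟨I.1, by
          rw [← Ideal.absNorm_ne_zero_iff_mem_nonZeroDivisors, I.2]; exact n.pos.ne'⟩,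
          PNat.eq I.2⟩
        left_inv := fun I => rfl
        right_inv := fun I => rfl }
    rw [tsum_const, Nat.card_congr ψ, lfCount, nsmul_eq_mul]
  set G : ℝ → ℝ := fun x => ∑' n : ℕ+, (lfCount E n : ℝ) * Real.exp (-n * x) with hG
  set κ := ∑ c, K c
  have hlim : Filter.Tendsto (fun x : ℝ => w * G x + classNumber E - κ / x)
      (nhdsWithin 0 (Set.Ioi 0)) (nhds 0) := by
    have h1 := tendsto_finsetSum (Finset.univ : Finset (ClassGroup (𝓞 E))) (fun c _ => hK c)
    rw [Finset.sum_const_zero] at h1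
    refine h1.congr' ?_
    filter_upwards [self_mem_nhdsWithin] with x hx
    have hx : 0 < x := hx
    simp only [hG]
    rw [hdec x hx, Finset.sum_sub_distrib, Finset.sum_add_distrib, ← Finset.mul_sum,
      ← Finset.sum_div, Finset.sum_const, Finset.card_univ, classNumber, nsmul_eq_mul, mul_one]
  have h2x : Filter.Tendsto (fun x : ℝ => 2 * x) (nhdsWithin 0 (Set.Ioi 0))
      (nhdsWithin 0 (Set.Ioi 0)) := by
    refine tendsto_nhdsWithin_iff.2 ⟨?_, ?_⟩
    · have : Filter.Tendsto (fun x : ℝ => 2 * x) (nhds 0) (nhds (2 * 0)) :=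
        (continuous_const.mul continuous_id).tendsto 0
      rw [mul_zero] at this
      exact this.mono_left nhdsWithin_le_nhds
    · filter_upwards [self_mem_nhdsWithin] with x hx
      have hx : 0 < x := hx
      show 0 < 2 * x
      positivity
  have h3 := (((hlim.comp h2x).const_mul 2).sub hlim).sub_const (classNumber E : ℝ)
  rw [mul_zero, sub_zero, zero_sub] at h3
  refine h3.congr' ?_
  filter_upwards [self_mem_nhdsWithin] with x hx
  have hx : 0 < x := hx
  simp only [Function.comp_apply]
  have : κ / (2 * x) = κ / x / 2 := by field_simp
  rw [this]
  change _ = w * (2 * G (2 * x) - G x)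
  ring

lemma lf_sum_conv {d : ℕ} [NeZero d] (χ : DirichletCharacter ℂ d) (hd : 1 < d) :
    ∑ j : ZMod d, χ j * ((j.val : ℂ) / d) =
      ∑ a ∈ Finset.Ioo 0 d, χ (a : ZMod d) * ((a : ℂ) / d) := by
  symm
  rw [← Finset.sum_subset (Finset.subset_univ (Finset.univ.erase (0 : ZMod d)))]
  · refine Finset.sum_bij (fun a _ => (a : ZMod d)) ?_ ?_ ?_ ?_
    · intro a ha
      rw [Finset.mem_Ioo] at ha
      rw [Finset.mem_erase]
      refine ⟨fun h => ?_, Finset.mem_univ _⟩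
      have := congrArg ZMod.val h
      rw [ZMod.val_cast_of_lt ha.2, ZMod.val_zero] at this
      omega
    · intro a ha b hb h
      rw [Finset.mem_Ioo] at ha hb
      have := congrArg ZMod.val h
      rwa [ZMod.val_cast_of_lt ha.2, ZMod.val_cast_of_lt hb.2] at this
    · intro j hj
      rw [Finset.mem_erase] at hj
      refine ⟨j.val, ?_, ZMod.natCast_zmod_val j⟩
      rw [Finset.mem_Ioo]
      exact ⟨Nat.pos_of_ne_zero fun h => hj.1 ((ZMod.val_eq_zero j).1 h), ZMod.val_lt j⟩
    · intro a ha
      rw [Finset.mem_Ioo] at ha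
      rw [ZMod.val_cast_of_lt ha.2]
  · intro j _ hj
    have : j = 0 := by simpa using hj
    rw [this, ZMod.val_zero]; simp

lemma lf_class_number_formula (E : Type*) [Field E] [NumberField E]
    {d : ℕ} [NeZero d] (hd1 : 1 < d)
    (hdeg : Module.finrank ℚ E = 2)
    (hdisc : NumberField.discr E = -(d : ℤ))
    (χ : DirichletCharacter ℂ d) (hχ1 : χ ≠ 1)
    (hχquad : ∀ u : (ZMod d)ˣ, χ u = 1 ∨ χ u = -1)
    (hχ : ∀ p : ℕ, p.Prime → ¬ p ∣ d →
      (χ (p : ZMod d) = -1 ↔ (Ideal.span {(p : 𝓞 E)} : Ideal (𝓞 E)).IsPrime)) :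
    (Nat.card (Units.torsion E) : ℂ) * ((∑ j : ZMod d, χ j * ((j.val : ℂ) / d)) / 2)
      = -(classNumber E : ℂ) := by
  have hneg : discr E < 0 := by rw [hdisc]; omega
  have h1 := (lf_lambert_lim χ hχ1 hd1).const_mul (Nat.card (Units.torsion E) : ℂ)
  have h2 := (Complex.continuous_ofReal.tendsto _).comp (lf_count_lim E hdeg hneg)
  have h3 : ∀ y : ℝ, (((∑' n : ℕ+, (lfCount E n : ℝ) * Real.exp (-n * y) : ℝ)) : ℂ) =
      ∑' n : ℕ+, lfR χ n * (Real.exp (-n * y) : ℂ) := by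
    intro y
    rw [Complex.ofReal_tsum]
    refine tsum_congr fun n => ?_
    rw [← lfCount_eq E hdeg hdisc χ hχquad hχ n.pos.ne']
    push_cast
    ring
  refine tendsto_nhds_unique (h1.congr fun x => ?_) (h2.trans ?_)
  · simp only [Function.comp_apply]
    rw [Complex.ofReal_mul, Complex.ofReal_sub, Complex.ofReal_mul, h3, h3]
    push_cast
    ring
  · rw [Complex.ofReal_neg, Complex.ofReal_natCast]

/-- **Lerch's formula.**
`E` is an imaginary quadratic field of discriminant `−d`, with class number `h`, number of
roots of unity `w`, and attached primitive quadratic Dirichlet character `χ` modulo `d`.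
Then `log d + L'(0,χ)/L(0,χ) = (w/(2h)) Σ_{0 < a < d} χ(a)·log Γ(a/d)`, where `L(s,χ)` is
the analytically continued Dirichlet L-function of `χ`. -/
theorem lerch_formula
    (E : Type*) [Field E] [NumberField E]
    (d : ℕ) (hd : 0 < d) [NeZero d]
    (hdeg : Module.finrank ℚ E = 2)
    (hdisc : NumberField.discr E = -(d : ℤ))
    (h w : ℕ)
    (hh : h = NumberField.classNumber E)
    (hw : w = Nat.card (NumberField.Units.torsion E))
    (χ : DirichletCharacter ℂ d)
    (hχprim : χ.IsPrimitive)
    (hχquad : ∀ u : (ZMod d)ˣ, χ u = 1 ∨ χ u = -1)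
    (hχ : ∀ p : ℕ, p.Prime → ¬ p ∣ d →
      (χ (p : ZMod d) = -1 ↔ (Ideal.span {(p : 𝓞 E)} : Ideal (𝓞 E)).IsPrime))
    (hL0 : DirichletCharacter.LFunction χ 0 ≠ 0) :
    (Real.log d : ℂ) +
        deriv (DirichletCharacter.LFunction χ) 0 / DirichletCharacter.LFunction χ 0 =
      ((w : ℂ) / (2 * h)) *
        ∑ a ∈ Finset.Ioo 0 d, χ (a : ZMod d) * (Real.log (Real.Gamma (a / d)) : ℂ) := by
  have hd1 : 1 < d := by
    have h1 := NumberField.abs_discr_gt_two (K := E) (by rw [hdeg]; norm_num)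
    rw [hdisc, abs_neg, Nat.abs_cast] at h1
    omega
  have hχ1 : χ ≠ 1 := by
    rintro rfl
    rw [DirichletCharacter.isPrimitive_def, DirichletCharacter.conductor_one] at hχprim
    omega
  have key := lf_class_number_formula E hd1 hdeg hdisc χ hχ1 hχquad hχ
  obtain ⟨e1, e2⟩ := lf_main χ hχ1 hd1
  rw [lf_sum_conv χ hd1, ← hw, ← hh] at key
  have hh0 : (h : ℂ) ≠ 0 := by
    rw [hh]; exact_mod_cast (Fintype.card_pos (α := ClassGroup (𝓞 E))).ne'
  have e3 : (w : ℂ) * DirichletCharacter.LFunction χ 0 = 2 * h := by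
    rw [e1]; linear_combination -2 * key
  have e4 : (w : ℂ) / (2 * h) = 1 / DirichletCharacter.LFunction χ 0 := by
    rw [div_eq_div_iff (by simpa using hh0) hL0, e3, one_mul]
  rw [e4, e2]
  field_simp
  ring
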